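/- There exists δ₀ > 0 such that for every δ with 0 < δ < δ₀ and every s > 0 there is a constant C_s < ∞ with the following property: for every solution (c_j)_{j∈ℤ} of the Fourier system for the equation i∂ₜu = −∂ₓₓu + 2δ·cos x·cos t·u such that Σ_{j∈ℤ} (1+j²)^s·|c_j(t)|² < ∞ for every t ∈ ℝ, one has Σ_{j∈ℤ} (1+j²)^s·|c_j(t)|² ≤ C_s·Σ_{j∈ℤ} (1+j²)^s·|c_j(0)|² for all t ∈ ℝ. -/

import Mathlib

noncomputable section

/-- The four-neighbour hopping operator on `ℤ × ℤ` with bond weights `κ`. -/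
def hop {H : Type*} [AddCommGroup H] [Module ℝ H] (κ : ℤ → ℝ) (Φ : ℤ → ℤ → H) (n k : ℤ) : H :=
  κ k • (Φ (n - 1) (k - 1) + Φ (n + 1) (k - 1)) +
    κ (k + 1) • (Φ (n - 1) (k + 1) + Φ (n + 1) (k + 1))

/-- `Φ` is a generalized eigenfunction of the Floquet operator `n + k² + ε hop` on `ℤ × ℤ`;
`F` stands for the quasi-energy applied to `Φ`. -/
structure IsLatticeMode {H : Type*} [NormedAddCommGroup H] [NormedSpace ℝ H]
    (ε : ℝ) (κ : ℤ → ℝ) (Φ F : ℤ → ℤ → H) : Prop where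
  eps_pos : 0 < ε
  eps_le : ε ≤ 1 / 20000
  weight_nonneg : ∀ k, 0 ≤ κ k
  weight_le_one : ∀ k, κ k ≤ 1
  eigen : ∀ n k : ℤ, F n k = ((n : ℝ) + (k : ℝ) ^ 2) • Φ n k + ε • hop κ Φ n k
  energy_le : ∀ n k, ‖F n k‖ ≤ 1 / 2 * ‖Φ n k‖
  summable : ∀ k, Summable fun n => ‖Φ n k‖

/-- The `ℓ¹` norm of the `k`-th column. -/
def columnNorm {H : Type*} [NormedAddCommGroup H] (Φ : ℤ → ℤ → H) (k : ℤ) : ℝ := ∑' n, ‖Φ n k‖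

lemma columnNorm_nonneg {H : Type*} [NormedAddCommGroup H] (Φ : ℤ → ℤ → H) (k : ℤ) :
    0 ≤ columnNorm Φ k :=
  tsum_nonneg fun _ => norm_nonneg _

namespace IsLatticeMode

variable {H : Type*} [NormedAddCommGroup H] [NormedSpace ℝ H]
  {ε : ℝ} {κ : ℤ → ℝ} {Φ F : ℤ → ℤ → H}


lemma norm_le_columnNorm (h : IsLatticeMode ε κ Φ F) (n k : ℤ) : ‖Φ n k‖ ≤ columnNorm Φ k :=
  (h.summable k).le_tsum n fun _ _ => norm_nonneg _

lemma norm_add_norm_le_columnNorm (h : IsLatticeMode ε κ Φ F) {m n : ℤ} (hmn : m ≠ n) (k : ℤ) :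
    ‖Φ m k‖ + ‖Φ n k‖ ≤ columnNorm Φ k := by
  have := (h.summable k).sum_le_tsum {m, n} fun _ _ => norm_nonneg _
  rwa [Finset.sum_pair hmn] at this

lemma norm_hop_le (h : IsLatticeMode ε κ Φ F) (n k : ℤ) :
    ‖hop κ Φ n k‖ ≤ ‖Φ (n - 1) (k - 1)‖ + ‖Φ (n + 1) (k - 1)‖ +
      (‖Φ (n - 1) (k + 1)‖ + ‖Φ (n + 1) (k + 1)‖) := by
  have aux : ∀ j (u v : H), ‖κ j • (u + v)‖ ≤ ‖u‖ + ‖v‖ := fun j u v => by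
    rw [norm_smul, Real.norm_of_nonneg (h.weight_nonneg j)]
    exact (mul_le_of_le_one_left (norm_nonneg _) (h.weight_le_one j)).trans (norm_add_le _ _)
  exact (norm_add_le _ _).trans (add_le_add (aux _ _ _) (aux _ _ _))

lemma norm_hop_le_of_columnNorm_le (h : IsLatticeMode ε κ Φ F) {k : ℤ} {B : ℝ}
    (h₁ : columnNorm Φ (k - 1) ≤ B) (h₂ : columnNorm Φ (k + 1) ≤ B) (n : ℤ) :
    ‖hop κ Φ n k‖ ≤ 2 * B := by
  have := h.norm_hop_le n k
  have := h.norm_add_norm_le_columnNorm (show n - 1 ≠ n + 1 by omega) (k - 1)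
  have := h.norm_add_norm_le_columnNorm (show n - 1 ≠ n + 1 by omega) (k + 1)
  linarith

/-- Off the resonant parabola the eigenvalue equation controls `Φ` by its neighbours. -/
lemma mul_norm_le (h : IsLatticeMode ε κ Φ F) {n k : ℤ} (hd : n + k ^ 2 ≠ 0) :
    |(n : ℝ) + (k : ℝ) ^ 2| * ‖Φ n k‖ ≤ 2 * ε * ‖hop κ Φ n k‖ := by
  have h1 : (1 : ℝ) ≤ |(n : ℝ) + (k : ℝ) ^ 2| := by
    have := Int.one_le_abs hd
    exact_mod_cast this
  have h2 : ‖((n : ℝ) + (k : ℝ) ^ 2) • Φ n k‖ ≤ ‖F n k‖ + ‖ε • hop κ Φ n k‖ := by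
    rw [show ((n : ℝ) + (k : ℝ) ^ 2) • Φ n k = F n k - ε • hop κ Φ n k by rw [h.eigen n k]; abel]
    exact norm_sub_le _ _
  rw [norm_smul, norm_smul, Real.norm_eq_abs, Real.norm_of_nonneg h.eps_pos.le] at h2
  have := h.energy_le n k
  nlinarith [norm_nonneg (Φ n k)]

lemma mul_norm_le_of_columnNorm_le (h : IsLatticeMode ε κ Φ F) {n k : ℤ} {B D : ℝ}
    (hD : D ≤ |(n : ℝ) + (k : ℝ) ^ 2|) (hd : n + k ^ 2 ≠ 0)
    (h₁ : columnNorm Φ (k - 1) ≤ B) (h₂ : columnNorm Φ (k + 1) ≤ B) :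
    D * ‖Φ n k‖ ≤ 4 * ε * B := by
  have a := h.mul_norm_le hd
  have b := h.norm_hop_le_of_columnNorm_le h₁ h₂ n
  have := mul_le_mul_of_nonneg_left b (mul_nonneg zero_le_two h.eps_pos.le)
  have := mul_le_mul_of_nonneg_right hD (norm_nonneg (Φ n k))
  linarith

lemma columnNorm_le (h : IsLatticeMode ε κ Φ F) (k : ℤ) :
    columnNorm Φ k ≤ ‖Φ (-k ^ 2) k‖ + 4 * ε * (columnNorm Φ (k - 1) + columnNorm Φ (k + 1)) := by
  have s1 : ∀ j, Summable fun n => ‖Φ (n - 1) j‖ := fun j =>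
    (Equiv.subRight (1 : ℤ)).summable_iff.2 (h.summable j)
  have s2 : ∀ j, Summable fun n => ‖Φ (n + 1) j‖ := fun j =>
    (Equiv.addRight (1 : ℤ)).summable_iff.2 (h.summable j)
  have t1 : ∀ j, ∑' n, ‖Φ (n - 1) j‖ = columnNorm Φ j := fun j =>
    (Equiv.subRight (1 : ℤ)).tsum_eq fun n => ‖Φ n j‖
  have t2 : ∀ j, ∑' n, ‖Φ (n + 1) j‖ = columnNorm Φ j := fun j =>
    (Equiv.addRight (1 : ℤ)).tsum_eq fun n => ‖Φ n j‖
  have hs := ((s1 (k - 1)).add (s2 (k - 1))).add ((s1 (k + 1)).add (s2 (k + 1)))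
  have ht : ∑' n, (‖Φ (n - 1) (k - 1)‖ + ‖Φ (n + 1) (k - 1)‖ +
      (‖Φ (n - 1) (k + 1)‖ + ‖Φ (n + 1) (k + 1)‖)) =
      2 * (columnNorm Φ (k - 1) + columnNorm Φ (k + 1)) := by
    rw [((s1 (k - 1)).add (s2 (k - 1))).tsum_add ((s1 (k + 1)).add (s2 (k + 1))),
      (s1 (k - 1)).tsum_add (s2 (k - 1)), (s1 (k + 1)).tsum_add (s2 (k + 1)), t1, t2, t1, t2]
    ring
  have hpt : ∀ n, ‖Φ n k‖ ≤ (if n = -k ^ 2 then ‖Φ (-k ^ 2) k‖ else 0) +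
      2 * ε * (‖Φ (n - 1) (k - 1)‖ + ‖Φ (n + 1) (k - 1)‖ +
      (‖Φ (n - 1) (k + 1)‖ + ‖Φ (n + 1) (k + 1)‖)) := by
    intro n
    have hε := h.eps_pos
    split_ifs with hn
    · rw [hn]
      have : 0 ≤ 2 * ε * (‖Φ (-k ^ 2 - 1) (k - 1)‖ + ‖Φ (-k ^ 2 + 1) (k - 1)‖ +
        (‖Φ (-k ^ 2 - 1) (k + 1)‖ + ‖Φ (-k ^ 2 + 1) (k + 1)‖)) := by positivity
      linarith
    · have hd : n + k ^ 2 ≠ 0 := by omega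
      have h1 : (1 : ℝ) ≤ |(n : ℝ) + (k : ℝ) ^ 2| := by
        have := Int.one_le_abs hd
        exact_mod_cast this
      have a := h.mul_norm_le hd
      have b := mul_le_mul_of_nonneg_left (h.norm_hop_le n k) (mul_nonneg zero_le_two hε.le)
      have c := mul_le_mul_of_nonneg_right h1 (norm_nonneg (Φ n k))
      linarith
  have hsi : Summable fun n : ℤ => if n = -k ^ 2 then ‖Φ (-k ^ 2) k‖ else 0 :=
    (hasSum_ite_eq _ _).summable
  have := (h.summable k).tsum_le_tsum hpt (hsi.add (hs.mul_left _))
  rw [hsi.tsum_add (hs.mul_left _), tsum_ite_eq, tsum_mul_left, ht] at this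
  unfold columnNorm at *
  linarith

/-- The weight of the bond joining `k` and `k + q`, where `q = ±1`. -/
def bond (κ : ℤ → ℝ) (k q : ℤ) : ℝ := if q = 1 then κ (k + 1) else κ k

lemma norm_hop_sub_le (h : IsLatticeMode ε κ Φ F) {p q : ℤ} (hp : p = 1 ∨ p = -1)
    (hq : q = 1 ∨ q = -1) (n k : ℤ) :
    ‖hop κ Φ (n + p) (k + q) - bond κ k q • Φ n k‖ ≤
      ‖Φ (n + 2 * p) k‖ + ‖Φ n (k + 2 * q)‖ + ‖Φ (n + 2 * p) (k + 2 * q)‖ := by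
  have aux : ∀ i j (u v w : H), ‖κ i • u + κ j • (v + w)‖ ≤ ‖u‖ + ‖v‖ + ‖w‖ := fun i j u v w => by
    refine (norm_add_le _ _).trans ?_
    rw [norm_smul, norm_smul, Real.norm_of_nonneg (h.weight_nonneg i),
      Real.norm_of_nonneg (h.weight_nonneg j)]
    have a := mul_le_of_le_one_left (norm_nonneg u) (h.weight_le_one i)
    have b := mul_le_of_le_one_left (norm_nonneg (v + w)) (h.weight_le_one j)
    have := norm_add_le v w
    linarith
  rcases hp with rfl | rfl <;> rcases hq with rfl | rfl <;>
    simp only [mul_one, mul_neg, ← sub_eq_add_neg]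
  · convert aux (k + 1) (k + 1 + 1) (Φ (n + 2) k) (Φ n (k + 2)) (Φ (n + 2) (k + 2)) using 2
    simp only [hop, bond, if_true, add_sub_cancel_right, add_assoc, smul_add, Int.reduceAdd]
    abel
  · convert aux (k - 1 + 1) (k - 1) (Φ (n + 2) k) (Φ n (k - 2)) (Φ (n + 2) (k - 2)) using 2
    simp only [hop, bond, add_sub_cancel_right, sub_add_cancel, add_assoc,
      sub_sub, smul_add, Int.reduceAdd, show (-1 : ℤ) ≠ 1 by decide, if_false]
    abel
  · convert aux (k + 1) (k + 1 + 1) (Φ (n - 2) k) (Φ n (k + 2)) (Φ (n - 2) (k + 2)) using 2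
    simp only [hop, bond, if_true, add_sub_cancel_right, sub_add_cancel,
      add_assoc, sub_sub, smul_add, Int.reduceAdd]
    abel
  · convert aux (k - 1 + 1) (k - 1) (Φ (n - 2) k) (Φ n (k - 2)) (Φ (n - 2) (k - 2)) using 2
    simp only [hop, bond, sub_add_cancel,
      sub_sub, smul_add, Int.reduceAdd, show (-1 : ℤ) ≠ 1 by decide, if_false]
    abel

lemma intCast_mul_norm_le (h : IsLatticeMode ε κ Φ F) {n k D : ℤ} {B : ℝ}
    (hD : D ≤ |n + k ^ 2|) (hd : n + k ^ 2 ≠ 0)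
    (h₁ : columnNorm Φ (k - 1) ≤ B) (h₂ : columnNorm Φ (k + 1) ≤ B) :
    (D : ℝ) * ‖Φ n k‖ ≤ 4 * ε * B :=
  h.mul_norm_le_of_columnNorm_le (by exact_mod_cast hD) hd h₁ h₂

lemma bond_nonneg (h : IsLatticeMode ε κ Φ F) (k q : ℤ) : 0 ≤ bond κ k q := by
  unfold bond; split_ifs <;> exact h.weight_nonneg _

lemma bond_le_one (h : IsLatticeMode ε κ Φ F) (k q : ℤ) : bond κ k q ≤ 1 := by
  unfold bond; split_ifs <;> exact h.weight_le_one _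

/-- First-order approximation of `Φ` at a neighbour of `(n, k)`. -/
lemma mul_norm_add_smul_le (h : IsLatticeMode ε κ Φ F) {p q : ℤ} (hp : p = 1 ∨ p = -1)
    (hq : q = 1 ∨ q = -1) {n k d : ℤ} (hd : n + p + (k + q) ^ 2 = d) (hd0 : d ≠ 0) :
    |(d : ℝ)| * ‖Φ (n + p) (k + q) + (ε * bond κ k q / d) • Φ n k‖ ≤
      ‖F (n + p) (k + q)‖ +
        ε * (‖Φ (n + 2 * p) k‖ + ‖Φ n (k + 2 * q)‖ + ‖Φ (n + 2 * p) (k + 2 * q)‖) := by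
  have hd1 : (d : ℝ) ≠ 0 := by exact_mod_cast hd0
  have e : (d : ℝ) • (Φ (n + p) (k + q) + (ε * bond κ k q / d) • Φ n k) =
      F (n + p) (k + q) - ε • (hop κ Φ (n + p) (k + q) - bond κ k q • Φ n k) := by
    rw [h.eigen, smul_add, smul_smul, mul_div_cancel₀ _ hd1, ← hd]
    push_cast
    module
  rw [← Real.norm_eq_abs, ← norm_smul, e]
  refine (norm_sub_le _ _).trans ?_
  rw [norm_smul, Real.norm_of_nonneg h.eps_pos.le]
  have := mul_le_mul_of_nonneg_left (h.norm_hop_sub_le hp hq n k) h.eps_pos.le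
  linarith

end IsLatticeMode

/-- The second-order energy shift of the resonant site in column `k`, divided by `-ε²`. -/
def resonantShift (κ : ℤ → ℝ) (k : ℤ) : ℝ :=
  κ k ^ 2 * (1 / (-2 * k) + 1 / (2 - 2 * k)) + κ (k + 1) ^ 2 * (1 / (2 * k) + 1 / (2 * k + 2))

namespace IsLatticeMode

variable {H : Type*} [NormedAddCommGroup H] [NormedSpace ℝ H]
  {ε : ℝ} {κ : ℤ → ℝ} {Φ F : ℤ → ℤ → H}

lemma norm_resonant_neighbour_le (h : IsLatticeMode ε κ Φ F) {k : ℤ} (hk : 2 ≤ |k|) {B μ : ℝ}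
    (hB : ∀ l, |l| ≤ 3 → columnNorm Φ (k + l) ≤ B) (hμ : 0 ≤ μ)
    (hF : ∀ n k, ‖F n k‖ ≤ μ * ‖Φ n k‖) {p q : ℤ} (hp : p = 1 ∨ p = -1) (hq : q = 1 ∨ q = -1) :
    ‖Φ (-k ^ 2 + p) (k + q) + (ε * bond κ k q / (p + 2 * q * k + 1 : ℤ)) • Φ (-k ^ 2) k‖ ≤
      (4 * ε * μ + 12 * ε ^ 2) * B / (k : ℝ) ^ 2 := by
  have hε := h.eps_pos
  have hε' := h.eps_le
  have hB' : ∀ j, |j - k| ≤ 3 → columnNorm Φ j ≤ B := fun j hj => by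
    simpa using hB (j - k) hj
  have hB0 : 0 ≤ B := (columnNorm_nonneg Φ (k + 0)).trans (hB 0 (by simp))
  set r : ℝ := |(k : ℝ)| with hr
  have hr2 : 2 ≤ r := by rw [hr]; exact_mod_cast hk
  have hrk : ((|k| : ℤ) : ℝ) = r := by simp [hr]
  have hr0 : 0 < r := by linarith
  have hrsq : (k : ℝ) ^ 2 = r * r := by rw [hr, ← sq, sq_abs]
  have divle : ∀ x y : ℝ, r * x ≤ y → x ≤ y / r := fun x y hxy => by
    rw [le_div_iff₀ hr0]; linarith
  -- bounds at the neighbour and at the three sites at distance two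
  have b0 : r * ‖Φ (-k ^ 2 + p) (k + q)‖ ≤ 4 * ε * B := by
    rw [← hrk]
    apply h.intCast_mul_norm_le
    · rcases hp with rfl | rfl <;> rcases hq with rfl | rfl <;> ring_nf <;>
        rcases abs_cases k with hh | hh <;> grind
    · rcases hp with rfl | rfl <;> rcases hq with rfl | rfl <;> ring_nf <;>
        rcases abs_cases k with hh | hh <;> omega
    · apply hB'; grind
    · apply hB'; grind
  have b2 : r * ‖Φ (-k ^ 2) (k + 2 * q)‖ ≤ 4 * ε * B := by
    rw [← hrk]
    apply h.intCast_mul_norm_le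
    · rcases hq with rfl | rfl <;> ring_nf <;>
        rcases abs_cases k with hh | hh <;> grind
    · rcases hq with rfl | rfl <;> ring_nf <;>
        rcases abs_cases k with hh | hh <;> omega
    · apply hB'; grind
    · apply hB'; grind
  have b3 : r * ‖Φ (-k ^ 2 + 2 * p) (k + 2 * q)‖ ≤ 4 * ε * B := by
    rw [← hrk]
    apply h.intCast_mul_norm_le
    · rcases hp with rfl | rfl <;> rcases hq with rfl | rfl <;> ring_nf <;>
        rcases abs_cases k with hh | hh <;> grind
    · rcases hp with rfl | rfl <;> rcases hq with rfl | rfl <;> ring_nf <;>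
        rcases abs_cases k with hh | hh <;> omega
    · apply hB'; grind
    · apply hB'; grind
  have b1 : r * ‖Φ (-k ^ 2 + 2 * p) k‖ ≤ 4 * ε * B := by
    have hd : -k ^ 2 + 2 * p + k ^ 2 ≠ 0 := by rcases hp with rfl | rfl <;> ring_nf <;> decide
    by_cases hk2 : |k| = 2
    · rw [← hrk, hk2]
      refine h.intCast_mul_norm_le ?_ hd (hB' _ (by grind)) (hB' _ (by grind))
      rcases hp with rfl | rfl <;> ring_nf <;> decide
    · have nb : ∀ p' q' : ℤ, (p' = 1 ∨ p' = -1) → (q' = 1 ∨ q' = -1) →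
          r * ‖Φ (-k ^ 2 + 2 * p + p') (k + q')‖ ≤ 8 * ε * B := by
        intro p' q' hp' hq'
        have : ((|k| : ℤ) : ℝ) / 2 * ‖Φ (-k ^ 2 + 2 * p + p') (k + q')‖ ≤ 4 * ε * B := by
          have hD : |k| ≤ 2 * |-k ^ 2 + 2 * p + p' + (k + q') ^ 2| := by
            rcases hp with rfl | rfl <;> rcases hp' with rfl | rfl <;> rcases hq' with rfl | rfl <;>
              ring_nf <;> rcases abs_cases k with hh | hh <;> grind
          apply h.mul_norm_le_of_columnNorm_le
          · rw [div_le_iff₀ two_pos, mul_comm]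
            exact_mod_cast hD
          · intro h0
            rw [h0] at hD
            simp at hD
            simp [hD] at hk
          · apply hB'; grind
          · apply hB'; grind
        rw [hrk] at this
        linarith
      have a := h.mul_norm_le hd
      have a' := h.norm_hop_le (-k ^ 2 + 2 * p) k
      have e : |((-k ^ 2 + 2 * p : ℤ) : ℝ) + (k : ℝ) ^ 2| = 2 := by
        push_cast
        rcases hp with rfl | rfl <;> norm_num
      rw [e] at a
      have n1 := nb (-1) (-1) (.inr rfl) (.inr rfl)
      have n2 := nb 1 (-1) (.inl rfl) (.inr rfl)
      have n3 := nb (-1) 1 (.inr rfl) (.inl rfl)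
      have n4 := nb 1 1 (.inl rfl) (.inl rfl)
      simp only [← sub_eq_add_neg] at n1 n2 n3
      have c : r * ‖hop κ Φ (-k ^ 2 + 2 * p) k‖ ≤ 32 * ε * B := by
        have := mul_le_mul_of_nonneg_left a' hr0.le
        linarith
      have c2 := mul_le_mul_of_nonneg_left c hε.le
      have c3 := mul_le_mul_of_nonneg_left a hr0.le
      have : 32 * ε * (ε * B) ≤ 4 * (ε * B) := by
        have : 0 ≤ ε * B := by positivity
        nlinarith
      linarith
  have hd : -k ^ 2 + p + (k + q) ^ 2 = p + 2 * q * k + 1 := by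
    rcases hq with rfl | rfl <;> ring
  have hdr : |k| ≤ |p + 2 * q * k + 1| := by
    rcases hp with rfl | rfl <;> rcases hq with rfl | rfl <;> ring_nf <;>
        rcases abs_cases k with hh | hh <;> grind
  have hd0 : p + 2 * q * k + 1 ≠ 0 := by
    intro h0
    rw [h0] at hdr
    simp at hdr
    simp [hdr] at hk
  have main := h.mul_norm_add_smul_le hp hq hd hd0
  set v := Φ (-k ^ 2 + p) (k + q) + (ε * bond κ k q / (p + 2 * q * k + 1 : ℤ)) • Φ (-k ^ 2) k
  have hdr' : r ≤ |((p + 2 * q * k + 1 : ℤ) : ℝ)| := by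
    rw [← hrk]; exact_mod_cast hdr
  have m1 := mul_le_mul_of_nonneg_right hdr' (norm_nonneg v)
  have m2 := hF (-k ^ 2 + p) (k + q)
  have m3 := mul_le_mul_of_nonneg_left b0 hμ
  have m4 : r * (r * ‖v‖) ≤ (4 * ε * μ + 12 * ε ^ 2) * B := by
    have := mul_le_mul_of_nonneg_left (m1.trans main) hr0.le
    have := mul_le_mul_of_nonneg_left m2 hr0.le
    have := mul_le_mul_of_nonneg_left (add_le_add (add_le_add b1 b2) b3) hε.le
    linarith
  rw [hrsq, le_div_iff₀ (by positivity)]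
  linarith

/-- Second-order perturbation theory at the resonant site of column `k`. -/
lemma norm_resonant_le (h : IsLatticeMode ε κ Φ F) {k : ℤ} (hk : 2 ≤ |k|) {B μ : ℝ}
    (hB : ∀ l, |l| ≤ 3 → columnNorm Φ (k + l) ≤ B) (hμ : 0 ≤ μ)
    (hF : ∀ n k, ‖F n k‖ ≤ μ * ‖Φ n k‖) :
    ‖F (-k ^ 2) k + (ε ^ 2 * resonantShift κ k) • Φ (-k ^ 2) k‖ ≤
      (16 * ε ^ 2 * μ + 48 * ε ^ 3) * B / (k : ℝ) ^ 2 := by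
  have nb := fun p q hp hq => h.norm_resonant_neighbour_le hk hB hμ hF (p := p) (q := q) hp hq
  have n1 := nb (-1) (-1) (.inr rfl) (.inr rfl)
  have n2 := nb 1 (-1) (.inl rfl) (.inr rfl)
  have n3 := nb (-1) 1 (.inr rfl) (.inl rfl)
  have n4 := nb 1 1 (.inl rfl) (.inl rfl)
  simp only [← sub_eq_add_neg] at n1 n2 n3
  set X := (4 * ε * μ + 12 * ε ^ 2) * B / (k : ℝ) ^ 2
  have e : F (-k ^ 2) k + (ε ^ 2 * resonantShift κ k) • Φ (-k ^ 2) k =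
      ε • (bond κ k (-1) • (Φ (-k ^ 2 - 1) (k - 1) +
          (ε * bond κ k (-1) / (-1 + 2 * (-1) * k + 1 : ℤ)) • Φ (-k ^ 2) k) +
        bond κ k (-1) • (Φ (-k ^ 2 + 1) (k - 1) +
          (ε * bond κ k (-1) / (1 + 2 * (-1) * k + 1 : ℤ)) • Φ (-k ^ 2) k) +
        bond κ k 1 • (Φ (-k ^ 2 - 1) (k + 1) +
          (ε * bond κ k 1 / (-1 + 2 * 1 * k + 1 : ℤ)) • Φ (-k ^ 2) k) +
        bond κ k 1 • (Φ (-k ^ 2 + 1) (k + 1) +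
          (ε * bond κ k 1 / (1 + 2 * 1 * k + 1 : ℤ)) • Φ (-k ^ 2) k)) := by
    have e1 : bond κ k 1 = κ (k + 1) := if_pos rfl
    have e2 : bond κ k (-1) = κ k := if_neg (by decide)
    rw [h.eigen, hop, e1, e2, resonantShift]
    push_cast
    rw [show (-1 + -2 * (k : ℝ) + 1) = -2 * k by ring,
      show (1 + -2 * (k : ℝ) + 1) = 2 - 2 * k by ring,
      show (-1 + 2 * (k : ℝ) + 1) = 2 * k by ring,
      show (1 + 2 * (k : ℝ) + 1) = 2 * k + 2 by ring]
    module
  have hs : ∀ q (v : H), ‖v‖ ≤ X → ‖bond κ k q • v‖ ≤ X := fun q v hv => by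
    rw [norm_smul, Real.norm_of_nonneg (h.bond_nonneg k q)]
    exact (mul_le_of_le_one_left (norm_nonneg _) (h.bond_le_one k q)).trans hv
  rw [e, norm_smul, Real.norm_of_nonneg h.eps_pos.le]
  have : (16 * ε ^ 2 * μ + 48 * ε ^ 3) * B / (k : ℝ) ^ 2 = ε * (X + X + X + X) := by
    simp only [X]; ring
  rw [this]
  refine mul_le_mul_of_nonneg_left ?_ h.eps_pos.le
  refine (norm_add_le _ _).trans (add_le_add ?_ (hs _ _ n4))
  refine (norm_add_le _ _).trans (add_le_add ?_ (hs _ _ n3))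
  exact (norm_add_le _ _).trans (add_le_add (hs _ _ n1) (hs _ _ n2))

/-- The nearly degenerate triple of sites `(-1, -1), (0, 0), (-1, 1)`. -/
lemma norm_central_le (h : IsLatticeMode ε κ Φ F) (hκ : ∀ j, |j| ≤ 4 → κ j = 1) {η B : ℝ}
    (hη₀ : 0 ≤ η) (hη : η ≤ ε ^ 2 / 2) (hF : ∀ n k, ‖F n k‖ ≤ η * ‖Φ n k‖)
    (hB : ∀ l, |l| ≤ 4 → columnNorm Φ l ≤ B) :
    ‖Φ 0 0‖ ≤ 100 * ε * B ∧ ‖Φ (-1) 1‖ ≤ 100 * ε * B ∧ ‖Φ (-1) (-1)‖ ≤ 100 * ε * B := by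
  have hε := h.eps_pos
  have hε' := h.eps_le
  have hB0 : 0 ≤ B := (columnNorm_nonneg Φ 0).trans (hB 0 (by simp))
  have hΦ : ∀ n k, |k| ≤ 4 → ‖Φ n k‖ ≤ B := fun n k hk => (h.norm_le_columnNorm n k).trans (hB k hk)
  have off : ∀ n k D : ℤ, D ≤ |n + k ^ 2| → n + k ^ 2 ≠ 0 → |k| ≤ 3 →
      (D : ℝ) * ‖Φ n k‖ ≤ 4 * ε * B := fun n k D hD hd hk =>
    h.intCast_mul_norm_le hD hd (hB _ (by grind)) (hB _ (by grind))
  have hηε : η * B ≤ ε ^ 2 / 2 * B := by gcongr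
  have hεB : 0 ≤ ε * B := by positivity
  have small : ε * (ε * B) ≤ 1 / 20000 * (ε * B) := by gcongr
  -- off-resonant sites
  have o11 : ∀ k : ℤ, k = 1 ∨ k = -1 → ‖Φ 1 k‖ ≤ 2 * (ε * B) := fun k hk => by
    have := off 1 k 2 (by rcases hk with rfl | rfl <;> decide)
      (by rcases hk with rfl | rfl <;> decide) (by rcases hk with rfl | rfl <;> decide)
    push_cast at this; linarith
  have o31 : ∀ k : ℤ, k = 1 ∨ k = -1 → ‖Φ (-3) k‖ ≤ 2 * (ε * B) := fun k hk => by
    have := off (-3) k 2 (by rcases hk with rfl | rfl <;> decide)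
      (by rcases hk with rfl | rfl <;> decide) (by rcases hk with rfl | rfl <;> decide)
    push_cast at this; linarith
  have o20 : ‖Φ (-2) 0‖ ≤ 2 * (ε * B) := by
    have := off (-2) 0 2 (by decide) (by decide) (by decide)
    push_cast at this; linarith
  have o22 : ∀ k : ℤ, k = 2 ∨ k = -2 → ‖Φ (-2) k‖ ≤ 2 * (ε * B) := fun k hk => by
    have := off (-2) k 2 (by rcases hk with rfl | rfl <;> decide)
      (by rcases hk with rfl | rfl <;> decide) (by rcases hk with rfl | rfl <;> decide)
    push_cast at this; linarith
  have o02 : ∀ k : ℤ, k = 2 ∨ k = -2 → ‖Φ 0 k‖ ≤ ε * B := fun k hk => by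
    have := off 0 k 4 (by rcases hk with rfl | rfl <;> decide)
      (by rcases hk with rfl | rfl <;> decide) (by rcases hk with rfl | rfl <;> decide)
    push_cast at this; linarith
  have o3 : ∀ n k : ℤ, n = -3 ∨ n = -1 ∨ n = 1 → k = 3 ∨ k = -3 → ‖Φ n k‖ ≤ ε * B :=
    fun n k hn hk => by
      have := off n k 4 (by rcases hn with rfl | rfl | rfl <;> rcases hk with rfl | rfl <;> decide)
        (by rcases hn with rfl | rfl | rfl <;> rcases hk with rfl | rfl <;> decide)
        (by rcases hk with rfl | rfl <;> decide)
      push_cast at this; linarith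
  have dv : ∀ x y : ℝ, ε * x ≤ ε * y → x ≤ y := fun x y hxy => le_of_mul_le_mul_left hxy hε
  have epsn : ∀ v : H, ‖ε • v‖ = ε * ‖v‖ := fun v => by rw [norm_smul, Real.norm_of_nonneg hε.le]
  -- symmetric combination
  have hs : ‖Φ (-1) 1 + Φ (-1) (-1)‖ ≤ 5 * (ε * B) := by
    have e : ε • (Φ (-1) 1 + Φ (-1) (-1)) = F 0 0 - ε • Φ 1 1 - ε • Φ 1 (-1) := by
      rw [h.eigen, hop, hκ 0 (by decide), hκ (0 + 1) (by decide)]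
      norm_num
      module
    apply dv
    rw [← epsn, e]
    have a := norm_sub_le (F 0 0 - ε • Φ 1 1) (ε • Φ 1 (-1))
    have b := norm_sub_le (F 0 0) (ε • Φ 1 1)
    rw [epsn] at a b
    have c := (hF 0 0).trans (mul_le_mul_of_nonneg_left (hΦ 0 0 (by decide)) hη₀)
    have d := mul_le_mul_of_nonneg_left (o11 1 (.inl rfl)) hε.le
    have d' := mul_le_mul_of_nonneg_left (o11 (-1) (.inr rfl)) hε.le
    nlinarith
  have e1 : F (-1) 1 = ε • (Φ (-2) 0 + Φ 0 0 + (Φ (-2) 2 + Φ 0 2)) := by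
    rw [h.eigen, hop, hκ 1 (by decide), hκ (1 + 1) (by decide)]
    norm_num
  have e2 : F (-1) (-1) = ε • (Φ (-2) 0 + Φ 0 0 + (Φ (-2) (-2) + Φ 0 (-2))) := by
    rw [h.eigen, hop, hκ (-1) (by decide), hκ (-1 + 1) (by decide)]
    norm_num
    abel
  have h0 : ‖Φ 0 0‖ ≤ 6 * (ε * B) := by
    have e : ε • Φ 0 0 = F (-1) 1 - ε • Φ (-2) 0 - ε • Φ (-2) 2 - ε • Φ 0 2 := by
      rw [e1]; module
    apply dv
    rw [← epsn, e]
    have a := norm_sub_le (F (-1) 1 - ε • Φ (-2) 0 - ε • Φ (-2) 2) (ε • Φ 0 2)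
    have a' := norm_sub_le (F (-1) 1 - ε • Φ (-2) 0) (ε • Φ (-2) 2)
    have b := norm_sub_le (F (-1) 1) (ε • Φ (-2) 0)
    rw [epsn] at a a' b
    have c := (hF (-1) 1).trans (mul_le_mul_of_nonneg_left (hΦ (-1) 1 (by decide)) hη₀)
    have d := mul_le_mul_of_nonneg_left o20 hε.le
    have d' := mul_le_mul_of_nonneg_left (o22 2 (.inl rfl)) hε.le
    have d'' := mul_le_mul_of_nonneg_left (o02 2 (.inl rfl)) hε.le
    nlinarith
  -- antisymmetric combination
  have n0 : ∀ q : ℤ, q = 1 ∨ q = -1 →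
      ‖Φ 0 (2 * q) + (ε / 4) • Φ (-1) q‖ ≤ 2 * (ε * (ε * B)) := fun q hq => by
    have a := h.mul_norm_add_smul_le (.inl rfl : (1 : ℤ) = 1 ∨ _) hq (n := -1) (k := q) (d := 4)
      (by rcases hq with rfl | rfl <;> decide) (by decide)
    have b1 := o11 q hq
    have b2 := o3 (-1) (q + 2 * q) (by simp) (by omega)
    have b3 := o3 1 (q + 2 * q) (by simp) (by omega)
    have b0 := hF 0 (2 * q)
    have b0' := mul_le_mul_of_nonneg_left (o02 (2 * q) (by omega)) hη₀
    have hb : bond κ q q = 1 := by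
      rcases hq with rfl | rfl
      · exact hκ (1 + 1) (by decide)
      · exact hκ (-1) (by decide)
    rw [hb, mul_one, ← two_mul q, show (-1 : ℤ) + 1 = 0 from rfl, show (-1 : ℤ) + 2 * 1 = 1 from rfl,
      show ((4 : ℤ) : ℝ) = 4 by norm_num, abs_of_pos (by norm_num)] at a
    have : 0 ≤ ε * (ε * B) := by positivity
    have c := mul_le_mul_of_nonneg_left (add_le_add (add_le_add b1 b2) b3) hε.le
    have d : η * (ε * B) ≤ ε * (ε * B) := by gcongr; nlinarith
    linarith
  have n2 : ∀ q : ℤ, q = 1 ∨ q = -1 →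
      ‖Φ (-2) (2 * q) + (ε / 2) • Φ (-1) q‖ ≤ 3 * (ε * (ε * B)) := fun q hq => by
    have a := h.mul_norm_add_smul_le (.inr rfl : (-1 : ℤ) = 1 ∨ _) hq (n := -1) (k := q) (d := 2)
      (by rcases hq with rfl | rfl <;> decide) (by decide)
    have b1 := o31 q hq
    have b2 := o3 (-1) (q + 2 * q) (by simp) (by omega)
    have b3 := o3 (-3) (q + 2 * q) (by simp) (by omega)
    have b0 := hF (-2) (2 * q)
    have b0' := mul_le_mul_of_nonneg_left (o22 (2 * q) (by omega)) hη₀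
    have hb : bond κ q q = 1 := by
      rcases hq with rfl | rfl
      · exact hκ (1 + 1) (by decide)
      · exact hκ (-1) (by decide)
    rw [hb, mul_one, ← two_mul q, show (-1 : ℤ) + -1 = -2 from rfl,
      show (-1 : ℤ) + 2 * -1 = -3 from rfl,
      show ((2 : ℤ) : ℝ) = 2 by norm_num, abs_of_pos (by norm_num)] at a
    have : 0 ≤ ε * (ε * B) := by positivity
    have c := mul_le_mul_of_nonneg_left (add_le_add (add_le_add b1 b2) b3) hε.le
    have d : η * (ε * B) ≤ ε * (ε * B) := by gcongr; nlinarith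
    linarith
  have ha : ‖Φ (-1) 1 - Φ (-1) (-1)‖ ≤ 60 * (ε * B) := by
    set b := Φ (-1) 1 - Φ (-1) (-1)
    have e : (3 / 4 * ε ^ 2) • b = ε • (Φ 0 (2 * 1) + (ε / 4) • Φ (-1) 1) +
        ε • (Φ (-2) (2 * 1) + (ε / 2) • Φ (-1) 1) - ε • (Φ 0 (2 * -1) + (ε / 4) • Φ (-1) (-1)) -
        ε • (Φ (-2) (2 * -1) + (ε / 2) • Φ (-1) (-1)) - F (-1) 1 + F (-1) (-1) := by
      rw [e1, e2]
      norm_num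
      module
    have e3 : ‖Φ (-1) 1‖ + ‖Φ (-1) (-1)‖ ≤ ‖b‖ + ‖Φ (-1) 1 + Φ (-1) (-1)‖ := by
      have a1 : Φ (-1) 1 = (1 / 2 : ℝ) • b + (1 / 2 : ℝ) • (Φ (-1) 1 + Φ (-1) (-1)) := by
        simp only [b]; module
      have a2 : Φ (-1) (-1) = (1 / 2 : ℝ) • (Φ (-1) 1 + Φ (-1) (-1)) - (1 / 2 : ℝ) • b := by
        simp only [b]; module
      have b1 := norm_add_le ((1 / 2 : ℝ) • b) ((1 / 2 : ℝ) • (Φ (-1) 1 + Φ (-1) (-1)))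
      have b2 := norm_sub_le ((1 / 2 : ℝ) • (Φ (-1) 1 + Φ (-1) (-1))) ((1 / 2 : ℝ) • b)
      rw [← a1, norm_smul, norm_smul] at b1
      rw [← a2, norm_smul, norm_smul] at b2
      norm_num at b1 b2
      linarith
    have e4 := congrArg norm e
    rw [norm_smul, Real.norm_of_nonneg (by positivity)] at e4
    have f1 := norm_add_le (ε • (Φ 0 (2 * 1) + (ε / 4) • Φ (-1) 1) +
        ε • (Φ (-2) (2 * 1) + (ε / 2) • Φ (-1) 1) - ε • (Φ 0 (2 * -1) + (ε / 4) • Φ (-1) (-1)) -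
        ε • (Φ (-2) (2 * -1) + (ε / 2) • Φ (-1) (-1)) - F (-1) 1) (F (-1) (-1))
    have f2 := norm_sub_le (ε • (Φ 0 (2 * 1) + (ε / 4) • Φ (-1) 1) +
        ε • (Φ (-2) (2 * 1) + (ε / 2) • Φ (-1) 1) - ε • (Φ 0 (2 * -1) + (ε / 4) • Φ (-1) (-1)) -
        ε • (Φ (-2) (2 * -1) + (ε / 2) • Φ (-1) (-1))) (F (-1) 1)
    have f3 := norm_sub_le (ε • (Φ 0 (2 * 1) + (ε / 4) • Φ (-1) 1) +
        ε • (Φ (-2) (2 * 1) + (ε / 2) • Φ (-1) 1) - ε • (Φ 0 (2 * -1) + (ε / 4) • Φ (-1) (-1)))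
        (ε • (Φ (-2) (2 * -1) + (ε / 2) • Φ (-1) (-1)))
    have f4 := norm_sub_le (ε • (Φ 0 (2 * 1) + (ε / 4) • Φ (-1) 1) +
        ε • (Φ (-2) (2 * 1) + (ε / 2) • Φ (-1) 1)) (ε • (Φ 0 (2 * -1) + (ε / 4) • Φ (-1) (-1)))
    have f5 := norm_add_le (ε • (Φ 0 (2 * 1) + (ε / 4) • Φ (-1) 1))
        (ε • (Φ (-2) (2 * 1) + (ε / 2) • Φ (-1) 1))
    rw [epsn] at f3 f4 f5
    rw [epsn] at f5
    have g1 := mul_le_mul_of_nonneg_left (n0 1 (.inl rfl)) hε.le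
    have g2 := mul_le_mul_of_nonneg_left (n0 (-1) (.inr rfl)) hε.le
    have g3 := mul_le_mul_of_nonneg_left (n2 1 (.inl rfl)) hε.le
    have g4 := mul_le_mul_of_nonneg_left (n2 (-1) (.inr rfl)) hε.le
    have k1 := hF (-1) 1
    have k2 := hF (-1) (-1)
    have k3 : η * (‖Φ (-1) 1‖ + ‖Φ (-1) (-1)‖) ≤ ε ^ 2 / 2 * (‖b‖ + 5 * (ε * B)) := by
      have := e3.trans (add_le_add le_rfl hs)
      exact mul_le_mul hη this (by positivity) (by positivity)
    have fin : ε ^ 2 * ‖b‖ ≤ ε ^ 2 * (60 * (ε * B)) := by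
      have : 0 ≤ ε * (ε * (ε * B)) := by positivity
      linarith
    exact le_of_mul_le_mul_left fin (by positivity)
  refine ⟨by linarith, ?_, ?_⟩
  · have a1 : (2 : ℝ) • Φ (-1) 1 = (Φ (-1) 1 - Φ (-1) (-1)) + (Φ (-1) 1 + Φ (-1) (-1)) := by module
    have a2 := congrArg norm a1
    rw [norm_smul, Real.norm_of_nonneg zero_le_two] at a2
    have := norm_add_le (Φ (-1) 1 - Φ (-1) (-1)) (Φ (-1) 1 + Φ (-1) (-1))
    linarith
  · have a1 : (2 : ℝ) • Φ (-1) (-1) = (Φ (-1) 1 + Φ (-1) (-1)) - (Φ (-1) 1 - Φ (-1) (-1)) := by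
      module
    have a2 := congrArg norm a1
    rw [norm_smul, Real.norm_of_nonneg zero_le_two] at a2
    have := norm_sub_le (Φ (-1) 1 + Φ (-1) (-1)) (Φ (-1) 1 - Φ (-1) (-1))
    linarith

/-- Modes of very small quasi-energy are small at the resonant sites. -/
lemma norm_le_of_energy_le (h : IsLatticeMode ε κ Φ F) {L : ℤ} (hL : 1 ≤ L)
    (hκ : ∀ j, |j| ≤ L + 3 → κ j = 1) (hF : ∀ n k, ‖F n k‖ ≤ ε ^ 2 / (2 * (L : ℝ) ^ 2) * ‖Φ n k‖)
    {k : ℤ} (hk : |k| ≤ L) {B : ℝ} (hB : ∀ l, |l| ≤ 5 → columnNorm Φ (k + l) ≤ B) :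
    ‖Φ (-k ^ 2) k‖ ≤ 100 * ε * B := by
  have hε := h.eps_pos
  have hε' := h.eps_le
  have hB0 : 0 ≤ B := (columnNorm_nonneg Φ (k + 0)).trans (hB 0 (by simp))
  have hL' : (1 : ℝ) ≤ L := by exact_mod_cast hL
  have hη : ε ^ 2 / (2 * (L : ℝ) ^ 2) ≤ ε ^ 2 / 2 := by
    gcongr
    nlinarith
  by_cases hk1 : |k| ≤ 1
  · obtain ⟨c0, c1, c2⟩ := h.norm_central_le (fun j hj => hκ j (by omega)) (by positivity) hη hF
      (B := B) fun l hl => by simpa using hB (l - k) (by grind)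
    have : k = 0 ∨ k = 1 ∨ k = -1 := by grind
    rcases this with rfl | rfl | rfl
    · simpa using c0
    · simpa using c1
    · simpa using c2
  · have a := h.norm_resonant_le (show 2 ≤ |k| by omega) (fun l hl => hB l (by omega))
      (by positivity) hF
    have hkr : (2 : ℝ) ≤ |(k : ℝ)| := by exact_mod_cast (show 2 ≤ |k| by omega)
    have hkL : |(k : ℝ)| ≤ L := by exact_mod_cast hk
    have hk4 : 4 ≤ (k : ℝ) ^ 2 := by rw [← sq_abs]; nlinarith
    have hkL2 : (k : ℝ) ^ 2 ≤ (L : ℝ) ^ 2 := by rw [← sq_abs]; gcongr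
    have hS : resonantShift κ k = -(1 / ((k : ℝ) ^ 2 - 1)) := by
      have n0 : (k : ℝ) ≠ 0 := by rintro h0; norm_num [h0] at hk4
      have n1 : (1 : ℝ) - k ≠ 0 := by intro h0; rw [show (k : ℝ) = 1 by linarith] at hk4; norm_num at hk4
      have n2 : (k : ℝ) + 1 ≠ 0 := by intro h0; rw [show (k : ℝ) = -1 by linarith] at hk4; norm_num at hk4
      have n3 : (k : ℝ) ^ 2 - 1 ≠ 0 := by linarith
      rw [resonantShift, hκ k (by omega), hκ (k + 1) (by grind),
        show (2 : ℝ) - 2 * k = 2 * (1 - k) by ring, show (2 : ℝ) * k + 2 = 2 * (k + 1) by ring]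
      field_simp
      ring
    set v := Φ (-k ^ 2) k
    have b : ε ^ 2 / (k : ℝ) ^ 2 * ‖v‖ ≤ ‖(ε ^ 2 * resonantShift κ k) • v‖ := by
      rw [norm_smul, hS, Real.norm_eq_abs, abs_mul, abs_neg, abs_of_pos (by positivity),
        abs_of_pos (by apply one_div_pos.2; linarith), mul_one_div]
      gcongr <;> linarith
    have c : ‖(ε ^ 2 * resonantShift κ k) • v‖ ≤
        ‖F (-k ^ 2) k + (ε ^ 2 * resonantShift κ k) • v‖ + ‖F (-k ^ 2) k‖ := by
      have := norm_sub_le (F (-k ^ 2) k + (ε ^ 2 * resonantShift κ k) • v) (F (-k ^ 2) k)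
      rwa [add_sub_cancel_left] at this
    have d : ‖F (-k ^ 2) k‖ ≤ ε ^ 2 / (2 * (k : ℝ) ^ 2) * ‖v‖ :=
      (hF _ _).trans (by gcongr)
    have e : (16 * ε ^ 2 * (ε ^ 2 / (2 * (L : ℝ) ^ 2)) + 48 * ε ^ 3) * B / (k : ℝ) ^ 2 ≤
        50 * ε ^ 3 * B / (k : ℝ) ^ 2 := by
      gcongr
      nlinarith [sq_nonneg ε, mul_le_mul_of_nonneg_left hη (sq_nonneg ε), pow_pos hε 3,
        mul_le_mul_of_nonneg_left hε' (pow_pos hε 3).le]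
    have f : ε ^ 2 / (k : ℝ) ^ 2 * ‖v‖ = 2 * (ε ^ 2 / (2 * (k : ℝ) ^ 2) * ‖v‖) := by
      field_simp
    have g : ε ^ 2 / (k : ℝ) ^ 2 * ‖v‖ ≤ ε ^ 2 / (k : ℝ) ^ 2 * (100 * ε * B) := by
      have : ε ^ 2 / (k : ℝ) ^ 2 * (100 * ε * B) = 2 * (50 * ε ^ 3 * B / (k : ℝ) ^ 2) := by ring
      linarith
    exact le_of_mul_le_mul_left g (by positivity)

/-- Modes whose quasi-energy is not too small are small at distant resonant sites. -/
lemma norm_le_of_le_energy (h : IsLatticeMode ε κ Φ F) {L : ℤ} (hL : 1 ≤ L)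
    (hκ : ∀ k, |κ (k + 1) ^ 2 - κ k ^ 2| * |(k : ℝ)| ≤ 3)
    (hF : ∀ n k, ε ^ 2 / (2 * (L : ℝ) ^ 2) * ‖Φ n k‖ ≤ ‖F n k‖)
    {k : ℤ} (hk : 2 ≤ |k|) {B : ℝ} (hB : ∀ l, |l| ≤ 3 → columnNorm Φ (k + l) ≤ B) :
    ‖Φ (-k ^ 2) k‖ ≤ 40 * (L : ℝ) ^ 2 * B / (k : ℝ) ^ 2 := by
  have hε := h.eps_pos
  have hε' := h.eps_le
  have hB0 : 0 ≤ B := (columnNorm_nonneg Φ (k + 0)).trans (hB 0 (by simp))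
  have hL' : (1 : ℝ) ≤ L := by exact_mod_cast hL
  have a := h.norm_resonant_le hk hB (by norm_num) h.energy_le
  set r := |(k : ℝ)| with hr
  have hkr : (2 : ℝ) ≤ r := by rw [hr]; exact_mod_cast hk
  have hk2 : (k : ℝ) ^ 2 = r ^ 2 := by rw [hr, sq_abs]
  have hS : |resonantShift κ k| ≤ 6 / (k : ℝ) ^ 2 := by
    have hk4 : 4 ≤ (k : ℝ) ^ 2 := by rw [hk2]; nlinarith
    have n0 : (k : ℝ) ≠ 0 := by rintro h0; norm_num [h0] at hk4
    have n1 : (1 : ℝ) - k ≠ 0 := by intro h0; rw [show (k : ℝ) = 1 by linarith] at hk4; norm_num at hk4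
    have n2 : (k : ℝ) + 1 ≠ 0 := by intro h0; rw [show (k : ℝ) = -1 by linarith] at hk4; norm_num at hk4
    have n3 : (k : ℝ) ^ 2 - 1 ≠ 0 := by linarith
    have e : resonantShift κ k = (κ (k + 1) ^ 2 - κ k ^ 2) * (1 / (2 * k) + 1 / (2 * (k + 1))) -
        κ k ^ 2 * (1 / ((k : ℝ) ^ 2 - 1)) := by
      rw [resonantShift, show (2 : ℝ) - 2 * k = 2 * (1 - k) by ring,
        show (2 : ℝ) * k + 2 = 2 * (k + 1) by ring]
      field_simp
      ring
    have d1 : |κ (k + 1) ^ 2 - κ k ^ 2| ≤ 3 / r := by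
      rw [le_div_iff₀ (by linarith)]; exact hκ k
    have d2 : |1 / (2 * (k : ℝ)) + 1 / (2 * (k + 1))| ≤ 3 / 2 / r := by
      refine (abs_add_le _ _).trans ?_
      rw [abs_div, abs_div, abs_mul, abs_mul, abs_one, abs_two, ← hr]
      have : r - 1 ≤ |(k : ℝ) + 1| := by
        have := abs_sub_abs_le_abs_sub (k : ℝ) (-1)
        rw [sub_neg_eq_add, abs_neg, abs_one] at this
        exact this
      have h1 : 1 / (2 * |(k : ℝ) + 1|) ≤ 1 / r := by
        apply one_div_le_one_div_of_le <;> linarith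
      have h2 : 1 / (2 * r) = 1 / 2 / r := by ring
      have h3 : 3 / 2 / r = 1 / 2 / r + 1 / r := by ring
      linarith
    have d3 : |κ k ^ 2 * (1 / ((k : ℝ) ^ 2 - 1))| ≤ 3 / 2 / r ^ 2 := by
      have c1 := h.weight_nonneg k
      have c2 := h.weight_le_one k
      rw [abs_of_nonneg (by apply mul_nonneg (sq_nonneg _); apply one_div_nonneg.2; linarith)]
      have c3 : κ k ^ 2 ≤ 1 := by nlinarith
      have c4 : 1 / ((k : ℝ) ^ 2 - 1) ≤ 3 / 2 / r ^ 2 := by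
        rw [div_le_div_iff₀ (by linarith) (by positivity)]
        linarith
      have c5 : 0 ≤ 1 / ((k : ℝ) ^ 2 - 1) := by apply one_div_nonneg.2; linarith
      exact (mul_le_of_le_one_left c5 c3).trans c4
    rw [hk2] at d3
    rw [e, hk2]
    refine (abs_sub _ _).trans ?_
    rw [abs_mul]
    have d4 := mul_le_mul d1 d2 (abs_nonneg _) (by positivity)
    have d5 : 6 / r ^ 2 = 3 / r * (3 / 2 / r) + 3 / 2 / r ^ 2 := by ring
    linarith
  set v := Φ (-k ^ 2) k
  have hv : ‖v‖ ≤ B := (h.norm_le_columnNorm _ _).trans (by simpa using hB 0 (by simp))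
  have c : ‖F (-k ^ 2) k‖ ≤
      ‖F (-k ^ 2) k + (ε ^ 2 * resonantShift κ k) • v‖ + ‖(ε ^ 2 * resonantShift κ k) • v‖ := by
    have := norm_sub_le (F (-k ^ 2) k + (ε ^ 2 * resonantShift κ k) • v)
      ((ε ^ 2 * resonantShift κ k) • v)
    rwa [add_sub_cancel_right] at this
  have b : ‖(ε ^ 2 * resonantShift κ k) • v‖ ≤ 6 * ε ^ 2 * B / (k : ℝ) ^ 2 := by
    rw [norm_smul, Real.norm_eq_abs, abs_mul, abs_of_pos (by positivity)]
    calc ε ^ 2 * |resonantShift κ k| * ‖v‖ ≤ ε ^ 2 * (6 / (k : ℝ) ^ 2) * B := by gcongr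
      _ = _ := by ring
  have d : (16 * ε ^ 2 * (1 / 2) + 48 * ε ^ 3) * B / (k : ℝ) ^ 2 ≤ 14 * ε ^ 2 * B / (k : ℝ) ^ 2 := by
    gcongr
    nlinarith [mul_le_mul_of_nonneg_left hε' (sq_nonneg ε)]
  have g : ε ^ 2 / (2 * (L : ℝ) ^ 2) * ‖v‖ ≤
      ε ^ 2 / (2 * (L : ℝ) ^ 2) * (40 * (L : ℝ) ^ 2 * B / (k : ℝ) ^ 2) := by
    have e : ε ^ 2 / (2 * (L : ℝ) ^ 2) * (40 * (L : ℝ) ^ 2 * B / (k : ℝ) ^ 2) =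
        6 * ε ^ 2 * B / (k : ℝ) ^ 2 + 14 * ε ^ 2 * B / (k : ℝ) ^ 2 := by
      field_simp; ring
    have := hF (-k ^ 2) k
    linarith
  exact le_of_mul_le_mul_left g (by positivity)

lemma columnNorm_le_of_bootstrap (h : IsLatticeMode ε κ Φ F) {m : ℤ → ℝ}
    (hm : ∀ k, m (k - 1) ≤ 2 * m k ∧ m (k + 1) ≤ 2 * m k) {Q₀ : ℝ} (hQ₀ : 0 ≤ Q₀)
    (h₀ : ∀ k, columnNorm Φ k ≤ Q₀ * m k)
    (step : ∀ Q, 0 ≤ Q → (∀ k, columnNorm Φ k ≤ Q * m k) →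
      ∀ k, ‖Φ (-k ^ 2) k‖ ≤ (1 + Q / 4) * m k) (k : ℤ) :
    columnNorm Φ k ≤ 2 * m k := by
  have hε := h.eps_pos
  have hε' := h.eps_le
  have hm0 : ∀ k, 0 ≤ m k := fun k => by
    have h1 := hm k
    have h2 := hm (k - 1)
    rw [sub_add_cancel] at h2
    linarith
  have key : ∀ i : ℕ, ∀ k, columnNorm Φ k ≤ (2 + Q₀ * (1 / 2) ^ i) * m k := by
    intro i
    induction i with
    | zero => intro k; have := h₀ k; have := hm0 k; simp; nlinarith
    | succ i ih =>
      intro k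
      have a := step _ (by positivity) ih k
      have b := h.columnNorm_le k
      set Q := 2 + Q₀ * (1 / 2) ^ i with hQ
      have hQ0 : 0 ≤ Q := by positivity
      have c : columnNorm Φ (k - 1) + columnNorm Φ (k + 1) ≤ 4 * (Q * m k) := by
        have := mul_le_mul_of_nonneg_left (hm k).1 hQ0
        have := mul_le_mul_of_nonneg_left (hm k).2 hQ0
        have := ih (k - 1)
        have := ih (k + 1)
        linarith
      have d : 4 * ε * (columnNorm Φ (k - 1) + columnNorm Φ (k + 1)) ≤
          4 * (1 / 20000) * (4 * (Q * m k)) := by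
        have := hm0 k
        apply mul_le_mul _ c (add_nonneg (columnNorm_nonneg Φ _) (columnNorm_nonneg Φ _))
          (by norm_num)
        linarith
      have e : (2 + Q₀ * (1 / 2) ^ (i + 1)) * m k = (1 + Q / 2) * m k := by
        rw [hQ, pow_succ]; ring
      have := mul_nonneg hQ0 (hm0 k)
      rw [e]
      linarith
  have lim : Filter.Tendsto (fun i : ℕ => (2 + Q₀ * (1 / 2 : ℝ) ^ i) * m k) Filter.atTop
      (nhds ((2 + Q₀ * 0) * m k)) :=
    ((tendsto_pow_atTop_nhds_zero_of_lt_one (by norm_num) (by norm_num)).const_mul Q₀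
      |>.const_add 2).mul_const _
  have := ge_of_tendsto' lim fun i => key i k
  simpa using this

/-- Low-energy modes are exponentially small in the central columns. -/
lemma columnNorm_le_of_energy_le (h : IsLatticeMode ε κ Φ F) (hΦ : ∀ n k, ‖Φ n k‖ ≤ 1)
    (hb : ∃ Q, ∀ k, columnNorm Φ k ≤ Q) {L : ℤ} (hL : 1 ≤ L)
    (hκ : ∀ j, |j| ≤ L + 3 → κ j = 1) (hF : ∀ n k, ‖F n k‖ ≤ ε ^ 2 / (2 * (L : ℝ) ^ 2) * ‖Φ n k‖)
    (k : ℤ) : columnNorm Φ k ≤ 2 * (1 / 2) ^ (L - |k|).toNat := by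
  have hε := h.eps_pos
  have hε' := h.eps_le
  have shift : ∀ (i : ℕ) (k l : ℤ), |l| ≤ i →
      (1 / 2 : ℝ) ^ (L - |k + l|).toNat ≤ 2 ^ i * (1 / 2) ^ (L - |k|).toNat := by
    intro i k l hl
    have : (L - |k|).toNat ≤ (L - |k + l|).toNat + i := by grind
    calc (1 / 2 : ℝ) ^ (L - |k + l|).toNat = 2 ^ i * (1 / 2) ^ ((L - |k + l|).toNat + i) := by
          rw [pow_add, mul_left_comm, ← mul_pow]; norm_num
      _ ≤ _ := by
          gcongr 2 ^ i * ?_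
          exact pow_le_pow_of_le_one (by norm_num) (by norm_num) this
  obtain ⟨Q, hQ⟩ := hb
  have hQ0 : 0 ≤ Q := (columnNorm_nonneg Φ 0).trans (hQ 0)
  refine h.columnNorm_le_of_bootstrap (m := fun k => (1 / 2) ^ (L - |k|).toNat)
    (Q₀ := Q * 2 ^ L.toNat) ?_ (by positivity) ?_ ?_ k
  · intro k
    have h1 := shift 1 k (-1) (by simp)
    have h2 := shift 1 k 1 (by simp)
    rw [pow_one] at h1 h2
    exact ⟨h1, h2⟩
  · intro k
    refine (hQ k).trans ?_
    rw [mul_assoc]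
    refine le_mul_of_one_le_right hQ0 ?_
    calc (1 : ℝ) = 2 ^ L.toNat * (1 / 2) ^ L.toNat := by rw [← mul_pow]; norm_num
      _ ≤ _ := by
          gcongr 2 ^ L.toNat * ?_
          exact pow_le_pow_of_le_one (by norm_num) (by norm_num) (by grind)
  · intro Q hQ0 hQ k
    by_cases hk : |k| ≤ L
    · have a := h.norm_le_of_energy_le hL hκ hF hk
        (B := Q * (2 ^ 5 * (1 / 2) ^ (L - |k|).toNat)) fun l hl =>
          (hQ _).trans (mul_le_mul_of_nonneg_left (shift 5 k l (by simpa using hl)) hQ0)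
      have m0 : (0 : ℝ) ≤ (1 / 2) ^ (L - |k|).toNat := by positivity
      have m1 := mul_nonneg hQ0 m0
      have := mul_le_mul_of_nonneg_right hε' m1
      linarith
    · have : (L - |k|).toNat = 0 := by omega
      simp only [this, pow_zero, mul_one]
      have := hΦ (-k ^ 2) k
      linarith

/-- Modes whose energy is not small are exponentially small in the outer columns. -/
lemma columnNorm_le_of_le_energy (h : IsLatticeMode ε κ Φ F) (hΦ : ∀ n k, ‖Φ n k‖ ≤ 1)
    {N : ℕ} (hN : ∀ n k : ℤ, (N : ℤ) < |k| → Φ n k = 0)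
    (hb : ∃ Q, ∀ k, columnNorm Φ k ≤ Q) {L : ℤ} (hL : 1 ≤ L)
    (hκ : ∀ k, |κ (k + 1) ^ 2 - κ k ^ 2| * |(k : ℝ)| ≤ 3)
    (hF : ∀ n k, ε ^ 2 / (2 * (L : ℝ) ^ 2) * ‖Φ n k‖ ≤ ‖F n k‖)
    (k : ℤ) : columnNorm Φ k ≤ 2 * (1 / 2) ^ (|k| - 40 * L).toNat := by
  have hε := h.eps_pos
  have hε' := h.eps_le
  have shift : ∀ (i : ℕ) (k l : ℤ), |l| ≤ i →
      (1 / 2 : ℝ) ^ (|k + l| - 40 * L).toNat ≤ 2 ^ i * (1 / 2) ^ (|k| - 40 * L).toNat := by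
    intro i k l hl
    have : (|k| - 40 * L).toNat ≤ (|k + l| - 40 * L).toNat + i := by grind
    calc (1 / 2 : ℝ) ^ (|k + l| - 40 * L).toNat =
          2 ^ i * (1 / 2) ^ ((|k + l| - 40 * L).toNat + i) := by
          rw [pow_add, mul_left_comm, ← mul_pow]; norm_num
      _ ≤ _ := by
          gcongr 2 ^ i * ?_
          exact pow_le_pow_of_le_one (by norm_num) (by norm_num) this
  obtain ⟨Q, hQ⟩ := hb
  have hQ0 : 0 ≤ Q := (columnNorm_nonneg Φ 0).trans (hQ 0)
  refine h.columnNorm_le_of_bootstrap (m := fun k => (1 / 2) ^ (|k| - 40 * L).toNat)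
    (Q₀ := Q * 2 ^ N) ?_ (by positivity) ?_ ?_ k
  · intro k
    have h1 := shift 1 k (-1) (by simp)
    have h2 := shift 1 k 1 (by simp)
    rw [pow_one] at h1 h2
    exact ⟨h1, h2⟩
  · intro k
    by_cases hk : (N : ℤ) < |k|
    · have : columnNorm Φ k = 0 := by simp [columnNorm, hN _ _ hk]
      rw [this]
      positivity
    refine (hQ k).trans ?_
    rw [mul_assoc]
    refine le_mul_of_one_le_right hQ0 ?_
    calc (1 : ℝ) = 2 ^ N * (1 / 2) ^ N := by rw [← mul_pow]; norm_num
      _ ≤ _ := by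
          gcongr 2 ^ N * ?_
          exact pow_le_pow_of_le_one (by norm_num) (by norm_num) (by omega)
  · intro Q hQ0 hQ k
    by_cases hk : 40 * L ≤ |k|
    · have a := h.norm_le_of_le_energy hL hκ hF (show 2 ≤ |k| by omega)
        (B := Q * (2 ^ 3 * (1 / 2) ^ (|k| - 40 * L).toNat)) fun l hl =>
          (hQ _).trans (mul_le_mul_of_nonneg_left (shift 3 k l (by simpa using hl)) hQ0)
      set M : ℝ := (1 / 2) ^ (|k| - 40 * L).toNat
      have m0 : 0 ≤ M := by positivity
      have hkr : 40 * (L : ℝ) ≤ |(k : ℝ)| := by exact_mod_cast hk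
      have hL' : (1 : ℝ) ≤ L := by exact_mod_cast hL
      have hk2 : 1600 * (L : ℝ) ^ 2 ≤ (k : ℝ) ^ 2 := by
        have := pow_le_pow_left₀ (by linarith) hkr 2
        rw [sq_abs] at this
        linarith
      have b : 40 * (L : ℝ) ^ 2 * (Q * (2 ^ 3 * M)) / (k : ℝ) ^ 2 ≤ Q / 4 * M := by
        rw [div_le_iff₀ (by nlinarith)]
        have := mul_nonneg hQ0 m0
        nlinarith [mul_le_mul_of_nonneg_left hk2 this]
      linarith
    · have : (|k| - 40 * L).toNat = 0 := by omega
      simp only [this, pow_zero, mul_one]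
      have := hΦ (-k ^ 2) k
      linarith

end IsLatticeMode

open Real in
/-- The `n`-th Fourier coefficient of a `2π`-periodic function. -/
def periodCoeff {H : Type*} [NormedAddCommGroup H] [NormedSpace ℂ H] (f : ℝ → H) (n : ℤ) : H :=
  (1 / (2 * π) : ℝ) • ∫ t in (0 : ℝ)..2 * π, Complex.exp (-(n * t * Complex.I)) • f t

namespace periodCoeff
open Real

variable {H : Type*} [NormedAddCommGroup H] [NormedSpace ℂ H] {f g : ℝ → H}

lemma continuous_integrand (hf : Continuous f) (n : ℤ) :
    Continuous fun t : ℝ => Complex.exp (-(n * t * Complex.I)) • f t := by fun_prop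

lemma norm_exp_eq_one (n : ℤ) (t : ℝ) : ‖Complex.exp (-(n * t * Complex.I))‖ = 1 := by
  rw [show (-(n * t * Complex.I) : ℂ) = ((-(n * t) : ℝ) : ℂ) * Complex.I by push_cast; ring]
  exact Complex.norm_exp_ofReal_mul_I _

lemma norm_le {C : ℝ} (h : ∀ t, ‖f t‖ ≤ C) (n : ℤ) : ‖periodCoeff f n‖ ≤ C := by
  have := intervalIntegral.norm_integral_le_of_norm_le_const (a := 0) (b := 2 * π)
    (f := fun t : ℝ => Complex.exp (-(n * t * Complex.I)) • f t) (C := C) fun t _ => by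
      rw [norm_smul, norm_exp_eq_one, one_mul]; exact h t
  rw [periodCoeff, norm_smul, Real.norm_of_nonneg (by positivity)]
  rw [sub_zero, abs_of_pos (by positivity)] at this
  calc _ ≤ 1 / (2 * π) * (C * (2 * π)) := by gcongr
    _ = C := by field_simp

lemma add (hf : Continuous f) (hg : Continuous g) (n : ℤ) :
    periodCoeff (fun t => f t + g t) n = periodCoeff f n + periodCoeff g n := by
  simp only [periodCoeff, smul_add]
  rw [intervalIntegral.integral_add ((continuous_integrand hf n).intervalIntegrable _ _)
    ((continuous_integrand hg n).intervalIntegrable _ _), smul_add]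

lemma const_smul (c : ℂ) (n : ℤ) :
    periodCoeff (fun t => c • f t) n = c • periodCoeff f n := by
  simp only [periodCoeff, smul_comm _ c, intervalIntegral.integral_smul]

lemma clm_apply [CompleteSpace H] {G : Type*} [NormedAddCommGroup G] [NormedSpace ℂ G]
    [CompleteSpace G] (T : H →L[ℂ] G) (hf : Continuous f) (n : ℤ) :
    periodCoeff (fun t => T (f t)) n = T (periodCoeff f n) := by
  simp only [periodCoeff, ← map_smul]
  rw [T.intervalIntegral_comp_comm ((continuous_integrand hf n).intervalIntegrable _ _)]
  exact (T.map_smul_of_tower _ _).symm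

lemma cos_smul (hf : Continuous f) (n : ℤ) :
    periodCoeff (fun t => (Real.cos t : ℂ) • f t) n =
      (1 / 2 : ℂ) • (periodCoeff f (n - 1) + periodCoeff f (n + 1)) := by
  have e : ∀ t : ℝ, Complex.exp (-(n * t * Complex.I)) • (Real.cos t : ℂ) • f t =
      (1 / 2 : ℂ) • (Complex.exp (-((n - 1 : ℤ) * t * Complex.I)) • f t +
        Complex.exp (-((n + 1 : ℤ) * t * Complex.I)) • f t) := by
    intro t
    rw [← add_smul, smul_smul, smul_smul]
    congr 1
    rw [Complex.ofReal_cos, Complex.cos,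
      show (-((n - 1 : ℤ) * t * Complex.I) : ℂ) = -(n * t * Complex.I) + t * Complex.I by
        push_cast; ring,
      show (-((n + 1 : ℤ) * t * Complex.I) : ℂ) = -(n * t * Complex.I) + -t * Complex.I by
        push_cast; ring, Complex.exp_add, Complex.exp_add]
    ring
  simp only [periodCoeff, e]
  rw [intervalIntegral.integral_smul, intervalIntegral.integral_add
    ((continuous_integrand hf _).intervalIntegrable _ _)
    ((continuous_integrand hf _).intervalIntegrable _ _), smul_comm, smul_add]

lemma deriv_eq [CompleteSpace H] (hp : Function.Periodic f (2 * π)) (hg : Continuous g)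
    (hd : ∀ t, HasDerivAt f (g t) t) (n : ℤ) :
    periodCoeff g n = (n * Complex.I) • periodCoeff f n := by
  have hf : Continuous f := continuous_iff_continuousAt.2 fun t => (hd t).continuousAt
  have hde : ∀ t : ℝ, HasDerivAt (fun t : ℝ => Complex.exp (-(n * t * Complex.I)) • f t)
      (Complex.exp (-(n * t * Complex.I)) • g t +
        (Complex.exp (-(n * t * Complex.I)) * (-(n * Complex.I))) • f t) t := by
    intro t
    have h1 : HasDerivAt (fun t : ℝ => (-(n * t * Complex.I) : ℂ)) (-(n * Complex.I)) t := by
      have := (((hasDerivAt_id t).ofReal_comp.const_mul (n : ℂ)).mul_const Complex.I).fun_neg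
      simpa using this
    exact h1.cexp.smul (hd t)
  have hi := intervalIntegral.integral_eq_sub_of_hasDerivAt (a := 0) (b := 2 * π)
    (fun t _ => hde t) (Continuous.intervalIntegrable (by fun_prop) _ _)
  have hend : Complex.exp (-(n * ((2 * π : ℝ) : ℂ) * Complex.I)) = 1 := by
    rw [show (-(n * ((2 * π : ℝ) : ℂ) * Complex.I) : ℂ) = ((-n : ℤ) : ℂ) * (2 * π * Complex.I) by
      push_cast; ring]
    exact Complex.exp_int_mul_two_pi_mul_I _
  have hf0 : f (2 * π) = f 0 := by simpa using hp 0
  rw [hend, hf0, intervalIntegral.integral_add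
    ((continuous_integrand hg n).intervalIntegrable _ _)
    (Continuous.intervalIntegrable (by fun_prop) _ _)] at hi
  simp only [Complex.ofReal_zero, mul_zero, zero_mul, neg_zero, Complex.exp_zero, sub_self,
    mul_comm (Complex.exp _), mul_smul, neg_smul] at hi
  rw [intervalIntegral.integral_neg] at hi
  simp only [intervalIntegral.integral_smul] at hi
  rw [periodCoeff, periodCoeff, add_neg_eq_zero.1 hi, mul_smul,
    smul_comm (1 / (2 * π) : ℝ) (n : ℂ), smul_comm (1 / (2 * π) : ℝ) Complex.I]

lemma norm_le_tsum [CompleteSpace H] (hp : Function.Periodic f (2 * π)) (hf : Continuous f)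
    (hs : Summable fun n => ‖periodCoeff f n‖) (t : ℝ) : ‖f t‖ ≤ ∑' n, ‖periodCoeff f n‖ := by
  have : Fact (0 < 2 * π) := ⟨by positivity⟩
  obtain ⟨T, hT, hTt⟩ := exists_dual_vector'' ℂ (f t)
  have hper : Function.Periodic (fun t => T (f t)) (2 * π) := fun t => by simp only [hp t]
  let φ : C(AddCircle (2 * π), ℂ) :=
    ⟨hper.lift, continuous_coinduced_dom.mpr (T.continuous.comp hf)⟩
  have hc : ∀ n, fourierCoeff φ n = T (periodCoeff f n) := by
    intro n
    rw [fourierCoeff_eq_intervalIntegral _ n 0, ← clm_apply T hf, periodCoeff, zero_add]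
    congr 2
    ext x
    rw [fourier_coe_apply]
    congr 2
    push_cast
    have : (π : ℂ) ≠ 0 := by exact_mod_cast pi_ne_zero
    field_simp
  have hb : ∀ n, ‖T (periodCoeff f n)‖ ≤ ‖periodCoeff f n‖ := fun n =>
    (T.le_opNorm _).trans (mul_le_of_le_one_left (norm_nonneg _) hT)
  have hs' : Summable (fourierCoeff φ) := .of_norm_bounded hs fun n => by rw [hc]; exact hb n
  have h1 := has_pointwise_sum_fourier_series_of_summable hs' (t : AddCircle (2 * π))
  have h2 : φ (t : AddCircle (2 * π)) = ‖f t‖ := hTt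
  rw [h2] at h1
  have h3 : ‖∑' n, fourierCoeff φ n • fourier n (t : AddCircle (2 * π))‖ ≤
      ∑' n, ‖periodCoeff f n‖ := by
    refine tsum_of_norm_bounded hs.hasSum fun n => ?_
    rw [norm_smul, hc, fourier_apply, Circle.norm_coe, mul_one]
    exact hb n
  rwa [h1.tsum_eq, Complex.norm_real, norm_norm] at h3

end periodCoeff

open Real in
/-- A `2π`-periodic solution with values in `H` of the hopping system with weights `κ`, shifted by
the quasi-energy operator `E`. -/
structure IsFloquetFamily {H : Type*} [NormedAddCommGroup H] [NormedSpace ℂ H]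
    (δ : ℝ) (κ : ℤ → ℝ) (E : H →L[ℂ] H) (Γ : ℤ → ℝ → H) : Prop where
  periodic : ∀ k, Function.Periodic (Γ k) (2 * π)
  hasDerivAt : ∀ k t, HasDerivAt (Γ k) ((-Complex.I) • (((k : ℂ) ^ 2 • Γ k t - E (Γ k t)) +
    (δ : ℂ) • (Real.cos t : ℂ) • ((κ k : ℂ) • Γ (k - 1) t + (κ (k + 1) : ℂ) • Γ (k + 1) t))) t
  norm_le_one : ∀ k t, ‖Γ k t‖ ≤ 1

namespace IsFloquetFamily
open Real

variable {H : Type*} [NormedAddCommGroup H] [NormedSpace ℂ H] {δ : ℝ} {κ : ℤ → ℝ}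
  {E : H →L[ℂ] H} {Γ : ℤ → ℝ → H}

lemma continuous (h : IsFloquetFamily δ κ E Γ) (k : ℤ) : Continuous (Γ k) :=
  continuous_iff_continuousAt.2 fun t => (h.hasDerivAt k t).continuousAt

lemma eigen [CompleteSpace H] (h : IsFloquetFamily δ κ E Γ) (n k : ℤ) :
    E (periodCoeff (Γ k) n) = ((n : ℝ) + (k : ℝ) ^ 2) • periodCoeff (Γ k) n +
      (δ / 2) • hop κ (fun n k => periodCoeff (Γ k) n) n k := by
  have hc := h.continuous
  have hcont : Continuous fun t => (-Complex.I) • (((k : ℂ) ^ 2 • Γ k t - E (Γ k t)) +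
      (δ : ℂ) • (Real.cos t : ℂ) • ((κ k : ℂ) • Γ (k - 1) t + (κ (k + 1) : ℂ) • Γ (k + 1) t)) := by
    have := hc k
    have := hc (k - 1)
    have := hc (k + 1)
    fun_prop
  have hd := periodCoeff.deriv_eq (h.periodic k) hcont (h.hasDerivAt k) n
  have hg : Continuous fun t => (κ k : ℂ) • Γ (k - 1) t + (κ (k + 1) : ℂ) • Γ (k + 1) t := by
    have := hc (k - 1)
    have := hc (k + 1)
    fun_prop
  have hg' : ∀ n, periodCoeff
      (fun t => (κ k : ℂ) • Γ (k - 1) t + (κ (k + 1) : ℂ) • Γ (k + 1) t) n =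
      (κ k : ℂ) • periodCoeff (Γ (k - 1)) n + (κ (k + 1) : ℂ) • periodCoeff (Γ (k + 1)) n := by
    intro n
    rw [periodCoeff.add (f := fun t => (κ k : ℂ) • Γ (k - 1) t)
      (g := fun t => (κ (k + 1) : ℂ) • Γ (k + 1) t) ((hc _).const_smul _) ((hc _).const_smul _),
      periodCoeff.const_smul,
      periodCoeff.const_smul]
  have hE : Continuous fun t => ((k : ℂ) ^ 2 • ContinuousLinearMap.id ℂ H - E) (Γ k t) :=
    (ContinuousLinearMap.continuous _).comp (hc k)
  have hcs : Continuous fun t : ℝ => (δ : ℂ) • (Real.cos t : ℂ) •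
      ((κ k : ℂ) • Γ (k - 1) t + (κ (k + 1) : ℂ) • Γ (k + 1) t) := by fun_prop
  rw [periodCoeff.const_smul, periodCoeff.add (f := fun t => (k : ℂ) ^ 2 • Γ k t - E (Γ k t)) hE hcs,
    periodCoeff.const_smul, periodCoeff.cos_smul hg, hg', hg'] at hd
  have h2 := periodCoeff.clm_apply ((k : ℂ) ^ 2 • ContinuousLinearMap.id ℂ H - E) (hc k) n
  simp only [sub_apply, smul_apply,
    ContinuousLinearMap.id_apply] at h2
  rw [h2] at hd
  have h3 := congrArg (fun v => Complex.I • v) hd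
  simp only [neg_smul, smul_neg] at h3
  rw [smul_smul Complex.I Complex.I, smul_smul Complex.I, mul_left_comm, Complex.I_mul_I,
    neg_smul, one_smul, neg_neg] at h3
  have h4 : E (periodCoeff (Γ k) n) = (n : ℂ) • periodCoeff (Γ k) n +
      (k : ℂ) ^ 2 • periodCoeff (Γ k) n + ((δ : ℂ) * (1 / 2)) •
        ((κ k : ℂ) • periodCoeff (Γ (k - 1)) (n - 1) +
          (κ (k + 1) : ℂ) • periodCoeff (Γ (k + 1)) (n - 1) +
        ((κ k : ℂ) • periodCoeff (Γ (k - 1)) (n + 1) +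
          (κ (k + 1) : ℂ) • periodCoeff (Γ (k + 1)) (n + 1))) := by
    rw [← sub_eq_zero] at h3 ⊢
    rw [← neg_eq_zero, ← h3]
    module
  rw [h4, hop]
  simp only [← Complex.coe_smul]
  push_cast
  module

/-- The space-time Fourier coefficients of a Floquet family form a lattice mode. -/
lemma isLatticeMode [CompleteSpace H] (h : IsFloquetFamily δ κ E Γ) (hδ : 0 < δ)
    (hδ' : δ ≤ 1 / 10000) (h₀ : ∀ k, 0 ≤ κ k) (h₁ : ∀ k, κ k ≤ 1)
    (hE : ∀ v, ‖E v‖ ≤ 1 / 2 * ‖v‖) :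
    IsLatticeMode (δ / 2) κ (fun n k => periodCoeff (Γ k) n)
      (fun n k => E (periodCoeff (Γ k) n)) := by
  have hop_le : ∀ n k, ‖hop κ (fun n k => periodCoeff (Γ k) n) n k‖ ≤
      ‖periodCoeff (Γ (k - 1)) (n - 1)‖ + ‖periodCoeff (Γ (k - 1)) (n + 1)‖ +
      (‖periodCoeff (Γ (k + 1)) (n - 1)‖ + ‖periodCoeff (Γ (k + 1)) (n + 1)‖) := by
    intro n k
    have aux : ∀ j (u v : H), ‖κ j • (u + v)‖ ≤ ‖u‖ + ‖v‖ := fun j u v => by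
      rw [norm_smul, Real.norm_of_nonneg (h₀ j)]
      exact (mul_le_of_le_one_left (norm_nonneg _) (h₁ j)).trans (norm_add_le _ _)
    exact (norm_add_le _ _).trans (add_le_add (aux _ _ _) (aux _ _ _))
  have bound : ∀ n k : ℤ, (1 + |(n : ℝ)|) * ‖periodCoeff (Γ k) n‖ ≤
      (2 + (k : ℝ) ^ 2) * ‖periodCoeff (Γ k) n‖ +
      (‖periodCoeff (Γ (k - 1)) (n - 1)‖ + ‖periodCoeff (Γ (k - 1)) (n + 1)‖ +
      (‖periodCoeff (Γ (k + 1)) (n - 1)‖ + ‖periodCoeff (Γ (k + 1)) (n + 1)‖)) := by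
    intro n k
    have a := norm_sub_le (E (periodCoeff (Γ k) n))
      ((δ / 2) • hop κ (fun n k => periodCoeff (Γ k) n) n k)
    rw [h.eigen, add_sub_cancel_right, ← h.eigen, norm_smul, norm_smul, Real.norm_eq_abs,
      Real.norm_of_nonneg (by positivity)] at a
    have b := hE (periodCoeff (Γ k) n)
    have c := hop_le n k
    have d : δ / 2 * ‖hop κ (fun n k => periodCoeff (Γ k) n) n k‖ ≤
      ‖hop κ (fun n k => periodCoeff (Γ k) n) n k‖ :=
      mul_le_of_le_one_left (norm_nonneg _) (by linarith)
    have e : |(n : ℝ)| ≤ |(n : ℝ) + (k : ℝ) ^ 2| + (k : ℝ) ^ 2 := by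
      have := abs_sub ((n : ℝ) + (k : ℝ) ^ 2) ((k : ℝ) ^ 2)
      rwa [add_sub_cancel_right, abs_of_nonneg (sq_nonneg (k : ℝ))] at this
    have f := mul_le_mul_of_nonneg_right e (norm_nonneg (periodCoeff (Γ k) n))
    have := norm_nonneg (periodCoeff (Γ k) n)
    linarith
  have decay : ∀ p : ℕ, ∀ k, ∃ C, 0 ≤ C ∧ ∀ n : ℤ,
      (1 + |(n : ℝ)|) ^ p * ‖periodCoeff (Γ k) n‖ ≤ C := by
    intro p
    induction p with
    | zero => exact fun k => ⟨1, zero_le_one, fun n => by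
        simpa using periodCoeff.norm_le (h.norm_le_one k) n⟩
    | succ p ih =>
      intro k
      obtain ⟨C, hC, hCn⟩ := ih k
      obtain ⟨C₁, hC₁, hCn₁⟩ := ih (k - 1)
      obtain ⟨C₂, hC₂, hCn₂⟩ := ih (k + 1)
      have near : ∀ n m : ℤ, |n - m| ≤ 1 → ∀ x : ℝ, 0 ≤ x → (1 + |(n : ℝ)|) ^ p * x ≤
          2 ^ p * ((1 + |(m : ℝ)|) ^ p * x) := by
        intro n m hnm x hx
        rw [← mul_assoc, ← mul_pow]
        have h1 : |(n : ℝ) - m| ≤ 1 := by exact_mod_cast hnm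
        have h2 := abs_sub_abs_le_abs_sub (n : ℝ) m
        have h3 := abs_nonneg (m : ℝ)
        gcongr
        linarith
      refine ⟨(2 + (k : ℝ) ^ 2) * C + (2 ^ p * C₁ + 2 ^ p * C₁ + (2 ^ p * C₂ + 2 ^ p * C₂)),
        by positivity, fun n => ?_⟩
      have a := mul_le_mul_of_nonneg_left (bound n k)
        (show (0 : ℝ) ≤ (1 + |(n : ℝ)|) ^ p by positivity)
      have b := mul_le_mul_of_nonneg_left (hCn n) (show (0 : ℝ) ≤ 2 + (k : ℝ) ^ 2 by positivity)
      have c := fun j m hm => near n m hm ‖periodCoeff (Γ j) m‖ (norm_nonneg _)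
      have c1 := c (k - 1) (n - 1) (by simp)
      have c2 := c (k - 1) (n + 1) (by simp)
      have c3 := c (k + 1) (n - 1) (by simp)
      have c4 := c (k + 1) (n + 1) (by simp)
      have p2 : (0 : ℝ) ≤ 2 ^ p := by positivity
      have d1 := mul_le_mul_of_nonneg_left (hCn₁ (n - 1)) p2
      have d2 := mul_le_mul_of_nonneg_left (hCn₁ (n + 1)) p2
      have d3 := mul_le_mul_of_nonneg_left (hCn₂ (n - 1)) p2
      have d4 := mul_le_mul_of_nonneg_left (hCn₂ (n + 1)) p2
      rw [pow_succ]
      linarith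
  refine ⟨by linarith, by linarith, h₀, h₁, h.eigen, fun n k => hE _, fun k => ?_⟩
  obtain ⟨C, hC, hCn⟩ := decay 2 k
  have hs : Summable fun n : ℤ => C * (1 / (n : ℝ) ^ 2) :=
    (Real.summable_one_div_int_pow.2 one_lt_two).mul_left C
  refine Summable.of_norm_bounded_eventually hs ?_
  rw [Filter.eventually_cofinite]
  refine (Set.finite_singleton (0 : ℤ)).subset fun n hn => ?_
  by_contra hn0
  apply hn
  have hn0' : (n : ℝ) ≠ 0 := by exact_mod_cast hn0
  have hn2 : 0 < (n : ℝ) ^ 2 := by positivity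
  rw [norm_norm, mul_one_div, le_div_iff₀ hn2]
  refine le_trans ?_ (hCn n)
  rw [mul_comm]
  refine mul_le_mul_of_nonneg_right ?_ (norm_nonneg _)
  rw [← sq_abs]
  exact pow_le_pow_left₀ (abs_nonneg _) (by linarith) 2

lemma norm_le_columnNorm [CompleteSpace H] (h : IsFloquetFamily δ κ E Γ)
    (hm : ∀ k, Summable fun n => ‖periodCoeff (Γ k) n‖) (k : ℤ) (t : ℝ) :
    ‖Γ k t‖ ≤ columnNorm (fun n k => periodCoeff (Γ k) n) k :=
  periodCoeff.norm_le_tsum (h.periodic k) (h.continuous k) (hm k) t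

lemma exists_columnNorm_le {N : ℕ} (hN : ∀ k : ℤ, (N : ℤ) < |k| → Γ k = 0) :
    ∃ Q, ∀ k, columnNorm (fun n k => periodCoeff (Γ k) n) k ≤ Q := by
  refine ⟨∑ k ∈ Finset.Icc (-N : ℤ) N, columnNorm (fun n k => periodCoeff (Γ k) n) k, fun k => ?_⟩
  by_cases hk : (N : ℤ) < |k|
  · have : columnNorm (fun n k => periodCoeff (Γ k) n) k = 0 := by
      simp [columnNorm, periodCoeff, hN k hk]
    rw [this]
    exact Finset.sum_nonneg fun _ _ => columnNorm_nonneg _ _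
  · exact Finset.single_le_sum (f := fun k => columnNorm (fun n k => periodCoeff (Γ k) n) k)
      (fun _ _ => columnNorm_nonneg _ _) (Finset.mem_Icc.2 (abs_le.1 (not_lt.1 hk)))

/-- Localisation of Floquet solutions with small quasi-energies. -/
lemma norm_le_of_energy_le [CompleteSpace H] (h : IsFloquetFamily δ κ E Γ) (hδ : 0 < δ)
    (hδ' : δ ≤ 1 / 10000) (h₀ : ∀ k, 0 ≤ κ k) (h₁ : ∀ k, κ k ≤ 1)
    (hE : ∀ v, ‖E v‖ ≤ 1 / 2 * ‖v‖) {N : ℕ} (hN : ∀ k : ℤ, (N : ℤ) < |k| → Γ k = 0)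
    {L : ℤ} (hL : 1 ≤ L) (hκ : ∀ j, |j| ≤ L + 3 → κ j = 1)
    (hEL : ∀ v, ‖E v‖ ≤ (δ / 2) ^ 2 / (2 * (L : ℝ) ^ 2) * ‖v‖) (k : ℤ) (t : ℝ) :
    ‖Γ k t‖ ≤ 2 * (1 / 2) ^ (L - |k|).toNat := by
  have hm := h.isLatticeMode hδ hδ' h₀ h₁ hE
  exact (h.norm_le_columnNorm hm.summable k t).trans <|
    hm.columnNorm_le_of_energy_le (fun n k => periodCoeff.norm_le (h.norm_le_one k) n)
      (exists_columnNorm_le hN) hL hκ (fun n k => hEL _) k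

/-- Localisation of Floquet solutions with quasi-energies away from zero. -/
lemma norm_le_of_le_energy [CompleteSpace H] (h : IsFloquetFamily δ κ E Γ) (hδ : 0 < δ)
    (hδ' : δ ≤ 1 / 10000) (h₀ : ∀ k, 0 ≤ κ k) (h₁ : ∀ k, κ k ≤ 1)
    (hE : ∀ v, ‖E v‖ ≤ 1 / 2 * ‖v‖) {N : ℕ} (hN : ∀ k : ℤ, (N : ℤ) < |k| → Γ k = 0)
    {L : ℤ} (hL : 1 ≤ L) (hκ : ∀ k, |κ (k + 1) ^ 2 - κ k ^ 2| * |(k : ℝ)| ≤ 3)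
    (hEL : ∀ v, (δ / 2) ^ 2 / (2 * (L : ℝ) ^ 2) * ‖v‖ ≤ ‖E v‖) (k : ℤ) (t : ℝ) :
    ‖Γ k t‖ ≤ 2 * (1 / 2) ^ (|k| - 40 * L).toNat := by
  have hm := h.isLatticeMode hδ hδ' h₀ h₁ hE
  exact (h.norm_le_columnNorm hm.summable k t).trans <|
    hm.columnNorm_le_of_le_energy (fun n k => periodCoeff.norm_le (h.norm_le_one k) n)
      (N := N) (fun n k hk => by simp [periodCoeff, hN k hk]) (exists_columnNorm_le hN) hL hκ
      (fun n k => hEL _) k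

end IsFloquetFamily

/-- The terms of the Dyson series of the linear equation `Y' = A Y`. -/
def dysonTerm {R : Type*} [NormedRing R] [NormedAlgebra ℝ R] (A : ℝ → R) : ℕ → ℝ → R
  | 0, _ => 1
  | n + 1, t => ∫ s in (0 : ℝ)..t, A s * dysonTerm A n s

section Dyson

variable {R : Type*} [NormedRing R] [NormedAlgebra ℝ R] {A : ℝ → R}

lemma continuous_dysonTerm (hA : Continuous A) (n : ℕ) : Continuous (dysonTerm A n) := by
  induction n with
  | zero => exact continuous_const
  | succ n ih =>
    exact intervalIntegral.continuous_primitive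
      (fun a b => (hA.mul ih).intervalIntegrable a b) 0

lemma hasDerivAt_dysonTerm_succ [CompleteSpace R] (hA : Continuous A) (n : ℕ) (t : ℝ) :
    HasDerivAt (dysonTerm A (n + 1)) (A t * dysonTerm A n t) t :=
  have hc : Continuous fun s => A s * dysonTerm A n s := hA.mul (continuous_dysonTerm hA n)
  intervalIntegral.integral_hasDerivAt_right (hc.intervalIntegrable _ _)
    (hc.stronglyMeasurableAtFilter _ _) hc.continuousAt

lemma dysonTerm_neg (n : ℕ) (t : ℝ) :
    dysonTerm A n (-t) = dysonTerm (fun s => -A (-s)) n t := by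
  induction n generalizing t with
  | zero => rfl
  | succ n ih =>
    have := intervalIntegral.integral_comp_neg (a := 0) (b := t)
      (fun s => A s * dysonTerm A n s)
    simp only [dysonTerm, ← ih, neg_mul, intervalIntegral.integral_neg]
    rw [this, neg_zero, intervalIntegral.integral_symm]

lemma norm_dysonTerm_le_of_nonneg {C : ℝ} (hC : ∀ t, ‖A t‖ ≤ C) (n : ℕ) {t : ℝ}
    (ht : 0 ≤ t) : ‖dysonTerm A n t‖ ≤ ‖(1 : R)‖ * ((C * t) ^ n / n.factorial) := by
  have hC₀ : 0 ≤ C := (norm_nonneg _).trans (hC 0)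
  induction n generalizing t with
  | zero => simp [dysonTerm]
  | succ n ih =>
    have key := intervalIntegral.norm_integral_le_of_norm_le (f := fun s => A s * dysonTerm A n s)
      (g := fun s => C * (‖(1 : R)‖ * ((C * s) ^ n / n.factorial))) (a := 0) (b := t)
      (μ := MeasureTheory.volume) ht
      (by
        refine Filter.Eventually.of_forall fun s hs => (norm_mul_le _ _).trans ?_
        exact mul_le_mul (hC s) (ih hs.1.le) (norm_nonneg _) hC₀)
      (Continuous.intervalIntegrable (by fun_prop) _ _)
    refine key.trans (le_of_eq ?_)
    have : (fun s : ℝ => C * (‖(1 : R)‖ * ((C * s) ^ n / n.factorial))) =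
        fun s => (C ^ (n + 1) * ‖(1 : R)‖ / n.factorial) * s ^ n := by
      ext s
      rw [mul_pow]
      ring
    rw [this, intervalIntegral.integral_const_mul, integral_pow, Nat.factorial_succ]
    have : (n.factorial : ℝ) ≠ 0 := by positivity
    push_cast
    field_simp
    ring

lemma norm_dysonTerm_le {C : ℝ} (hC : ∀ t, ‖A t‖ ≤ C) (n : ℕ) (t : ℝ) :
    ‖dysonTerm A n t‖ ≤ ‖(1 : R)‖ * ((C * |t|) ^ n / n.factorial) := by
  rcases le_total 0 t with ht | ht
  · rw [abs_of_nonneg ht]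
    exact norm_dysonTerm_le_of_nonneg hC n ht
  · rw [abs_of_nonpos ht, ← neg_neg t, dysonTerm_neg, neg_neg]
    exact norm_dysonTerm_le_of_nonneg (fun s => by simpa using hC (-s)) n
      (neg_nonneg.2 ht)

/-- Global solvability of linear equations with bounded continuous coefficients. -/
lemma exists_fundamental_solution [CompleteSpace R] (hA : Continuous A) {C : ℝ} (hC : ∀ t, ‖A t‖ ≤ C) :
    ∃ Y : ℝ → R, Y 0 = 1 ∧ ∀ t, HasDerivAt Y (A t * Y t) t := by
  have hC₀ : 0 ≤ C := (norm_nonneg _).trans (hC 0)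
  have hsum : ∀ T : ℝ, Summable fun n : ℕ => ‖(1 : R)‖ * ((C * T) ^ n / n.factorial) := fun T =>
    (Real.summable_pow_div_factorial _).mul_left _
  have hs : ∀ t, Summable fun n => dysonTerm A n t := fun t =>
    .of_norm_bounded (hsum |t|) fun n => norm_dysonTerm_le hC n t
  have h0 : ∀ n, dysonTerm A (n + 1) 0 = 0 := fun n => by simp [dysonTerm]
  have hY : ∀ t, ∑' n, dysonTerm A n t = 1 + ∑' n, dysonTerm A (n + 1) t := fun t =>
    (hs t).tsum_eq_zero_add
  refine ⟨fun t => ∑' n, dysonTerm A n t, by simp [hY, h0], fun t => ?_⟩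
  simp_rw [← (hs t).tsum_mul_left]
  rw [funext hY]
  refine HasDerivAt.const_add _ ?_
  have ht : t ∈ Set.Ioo (-(|t| + 1)) (|t| + 1) := abs_lt.1 (lt_add_one _)
  refine hasDerivAt_tsum_of_isPreconnected ((hsum (|t| + 1)).mul_left C) isOpen_Ioo
    isPreconnected_Ioo (fun n y _ => hasDerivAt_dysonTerm_succ hA n y) (fun n y hy => ?_) ht
    ((summable_nat_add_iff 1).2 (hs t)) ht
  refine (norm_mul_le _ _).trans (mul_le_mul (hC y) ((norm_dysonTerm_le hC n y).trans ?_)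
    (norm_nonneg _) hC₀)
  have := (abs_lt.2 hy).le
  gcongr

end Dyson

open Matrix in
open scoped Matrix.Norms.L2Operator in
/-- Unitary matrices are unitarily diagonalizable. -/
lemma Matrix.exists_unitary_diagonalization {ι : Type*} [Fintype ι] [DecidableEq ι]
    {M : Matrix ι ι ℂ} (hM : M ∈ unitary (Matrix ι ι ℂ)) :
    ∃ W : Matrix ι ι ℂ, W ∈ unitary (Matrix ι ι ℂ) ∧ ∃ θ : ι → ℝ,
      M * W = W * diagonal fun v => Complex.exp (Complex.I * θ v) := by
  have hn : IsStarNormal M := ⟨by rw [Commute, SemiconjBy, hM.1, hM.2]⟩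
  set h : Matrix ι ι ℂ := cfc ((↑) ∘ Complex.arg : ℂ → ℂ) M with hh
  have hsa : IsSelfAdjoint h := IsSelfAdjoint.cfc_arg M
  have hherm : h.IsHermitian := hsa
  have hexp : NormedSpace.exp (Complex.I • h) = M := by
    have hc : ContinuousOn ((↑) ∘ Complex.arg : ℂ → ℂ) (spectrum ℂ M) :=
      (Matrix.finite_spectrum M).continuousOn _
    rw [← CFC.exp_eq_normedSpace_exp (𝕜 := ℂ), ← cfc_comp_smul .., hh, ← cfc_comp' ..]
    conv_rhs => rw [← cfc_id' ℂ M]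
    refine cfc_congr fun y hy ↦ ?_
    have hy₁ : ‖y‖ = 1 := spectrum.norm_eq_one_of_unitary hM hy
    have : Complex.I * y.arg = Complex.log y :=
      Complex.ext (by simp [Complex.log_re, hy₁]) (by simp [Complex.log_im])
    simpa [← Complex.exp_eq_exp_ℂ, this] using Complex.exp_log (by aesop)
  obtain ⟨W, hW⟩ : ∃ W : Matrix ι ι ℂ, W = hherm.eigenvectorUnitary.1 := ⟨_, rfl⟩
  have hWu : W ∈ unitary (Matrix ι ι ℂ) := hW ▸ hherm.eigenvectorUnitary.2
  refine ⟨W, hWu, hherm.eigenvalues, ?_⟩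
  have hinv : W⁻¹ = star W := Matrix.inv_eq_left_inv hWu.1
  have hdiag : h = W * diagonal ((↑) ∘ hherm.eigenvalues : ι → ℂ) * W⁻¹ := by
    rw [hinv, hW]
    exact hherm.spectral_theorem
  have hu : IsUnit W := ⟨⟨W, star W, hWu.2, hWu.1⟩, rfl⟩
  have h1 : Complex.I • h =
      W * diagonal (fun v => Complex.I * (hherm.eigenvalues v : ℂ)) * W⁻¹ := by
    conv_lhs => rw [hdiag]
    rw [← smul_mul_assoc, ← mul_smul_comm, ← diagonal_smul]
    rfl
  rw [← hexp, h1, Matrix.exp_conj _ _ hu, Matrix.exp_diagonal, mul_assoc _ W⁻¹, hinv, hWu.1, mul_one]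
  congr 2
  ext v
  rw [Pi.coe_exp, Complex.exp_eq_exp_ℂ]

open Matrix Real in
open scoped Matrix.Norms.L2Operator in
/-- **Floquet theorem** for periodic Hermitian systems. -/
lemma Matrix.exists_floquet {ι : Type*} [Fintype ι] [DecidableEq ι] {A : ℝ → Matrix ι ι ℂ}
    (hA : Continuous A) (hH : ∀ t, (A t).IsHermitian) (hP : Function.Periodic A (2 * π)) :
    ∃ (E : ι → ℝ) (G : ℝ → Matrix ι ι ℂ), (∀ v, |E v| ≤ 1 / 2) ∧
      (∀ t, G t ∈ unitary (Matrix ι ι ℂ)) ∧ Function.Periodic G (2 * π) ∧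
      ∀ k v t, HasDerivAt (fun t => G t k v)
        (-Complex.I * ((A t * G t) k v - E v * G t k v)) t := by
  obtain ⟨C, hC⟩ : ∃ C, ∀ t, ‖-Complex.I • A t‖ ≤ C := by
    obtain ⟨C, hC⟩ := (isCompact_Icc (a := (0 : ℝ)) (b := 2 * π)).exists_bound_of_continuousOn
      hA.continuousOn
    refine ⟨C, fun t => ?_⟩
    obtain ⟨y, hy, hyt⟩ := hP.exists_mem_Ico₀ (by positivity) t
    rw [norm_smul, hyt]
    simpa using hC y ⟨hy.1, hy.2.le⟩
  obtain ⟨Y, hY0, hY⟩ := exists_fundamental_solution (A := fun t => -Complex.I • A t)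
    (by fun_prop) hC
  have hconst : ∀ T, (A ∘ (· + T) = A) → ∀ t, star (Y t) * Y (t + T) = Y T := by
    intro T hT t
    have hd : ∀ t, HasDerivAt (fun t => star (Y t) * Y (t + T)) 0 t := by
      intro t
      have h1 := (hY t).star
      have h2 := (hY (t + T)).comp_add_const t T
      refine (h1.mul h2).congr_deriv ?_
      have : A (t + T) = A t := congrFun hT t
      have hs : star (A t) = A t := hH t
      simp only [this, neg_smul, neg_mul, star_neg, star_mul, star_smul, hs]
      simp [mul_assoc]
    have := is_const_of_deriv_eq_zero (fun t => (hd t).differentiableAt) (fun t => (hd t).deriv) t 0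
    simpa [hY0] using this
  have hYu : ∀ t, Y t ∈ unitary (Matrix ι ι ℂ) := by
    intro t
    have := hconst 0 (by ext; simp) t
    rw [add_zero, hY0] at this
    exact ⟨this, mul_eq_one_comm.1 this⟩
  obtain ⟨W, hW, θ, hθ⟩ := Matrix.exists_unitary_diagonalization (hYu (2 * π))
  set x : ι → ℝ := fun v => -θ v / (2 * π) with hx
  set E : ι → ℝ := fun v => x v - round (x v) with hE
  have hM : ∀ v, Complex.exp (Complex.I * θ v) * Complex.exp (Complex.I * E v * (2 * π : ℝ)) = 1 := by
    intro v
    rw [← Complex.exp_add, Complex.exp_eq_one_iff]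
    refine ⟨-round (x v), ?_⟩
    simp only [hE, hx]
    push_cast
    have : (π : ℂ) ≠ 0 := by exact_mod_cast pi_ne_zero
    field_simp
    ring
  set G : ℝ → Matrix ι ι ℂ := fun t =>
    Y t * (W * diagonal fun v => Complex.exp (Complex.I * E v * t)) with hG
  have hDu : ∀ t : ℝ, (diagonal fun v => Complex.exp (Complex.I * E v * t)) ∈
      unitary (Matrix ι ι ℂ) := by
    intro t
    have : ∀ v, star (Complex.exp (Complex.I * E v * t)) * Complex.exp (Complex.I * E v * t) = 1 := by
      intro v
      rw [Complex.star_def, ← Complex.exp_conj, ← Complex.exp_add]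
      simp
    have h1 : star (diagonal fun v => Complex.exp (Complex.I * E v * t)) *
        (diagonal fun v => Complex.exp (Complex.I * E v * t)) = 1 := by
      rw [star_eq_conjTranspose, diagonal_conjTranspose, diagonal_mul_diagonal, ← diagonal_one]
      congr 1
      ext v
      exact this v
    exact ⟨h1, mul_eq_one_comm.1 h1⟩
  refine ⟨E, G, fun v => abs_sub_round _, fun t => mul_mem (hYu t) (mul_mem hW (hDu t)), ?_, ?_⟩
  · intro t
    have h1 : Y (t + 2 * π) = Y t * Y (2 * π) := by
      rw [← hconst (2 * π) (funext hP) t, ← mul_assoc, (hYu t).2, one_mul]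
    simp only [hG]
    rw [h1, mul_assoc, ← mul_assoc (Y (2 * π)), hθ, mul_assoc W, diagonal_mul_diagonal]
    congr 3
    ext v
    have := hM v
    push_cast at this ⊢
    rw [mul_add, Complex.exp_add, mul_left_comm, this, mul_one]
  · intro k v t
    have h1 : ∀ t, G t k v = (Y t * W) k v * Complex.exp (Complex.I * E v * t) := fun t => by
      simp only [hG, ← mul_assoc, mul_diagonal]
    have h2 : HasDerivAt (fun t => (Y t * W) k v) ((-Complex.I • (A t * (Y t * W))) k v) t := by
      have := (Matrix.entryLinearMap ℝ ℂ k v).toContinuousLinearMap.hasFDerivAt.comp_hasDerivAt t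
        ((hY t).mul_const W)
      rw [smul_mul_assoc, smul_mul_assoc, mul_assoc] at this
      exact this
    have h3 : HasDerivAt (fun t : ℝ => Complex.exp (Complex.I * E v * t))
        (Complex.exp (Complex.I * E v * t) * (Complex.I * E v)) t := by
      have := ((hasDerivAt_id (t : ℂ)).const_mul (Complex.I * E v)).cexp.comp_ofReal
      simpa using this
    rw [funext h1]
    refine (h2.mul h3).congr_deriv ?_
    have : (A t * G t) k v = (A t * (Y t * W)) k v * Complex.exp (Complex.I * E v * t) := by
      simp only [hG, ← mul_assoc, mul_diagonal]
    rw [h1, this, Matrix.smul_apply, smul_eq_mul]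
    ring

open Matrix in
lemma Matrix.norm_toLp_unitary_mulVec {ι : Type*} [Fintype ι] [DecidableEq ι] {U : Matrix ι ι ℂ}
    (hU : U ∈ unitary (Matrix ι ι ℂ)) (x : ι → ℂ) :
    ‖WithLp.toLp 2 (U *ᵥ x)‖ = ‖WithLp.toLp 2 x‖ := by
  rw [← sq_eq_sq₀ (norm_nonneg _) (norm_nonneg _), ← @inner_self_eq_norm_sq ℂ,
    ← @inner_self_eq_norm_sq ℂ, EuclideanSpace.inner_eq_star_dotProduct,
    EuclideanSpace.inner_eq_star_dotProduct]
  have h : Uᴴ * U = 1 := hU.1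
  simp only [star_mulVec]
  rw [dotProduct_comm, ← dotProduct_mulVec, mulVec_mulVec, h, one_mulVec, dotProduct_comm]

lemma EuclideanSpace.norm_toLp_le {ι : Type*} [Fintype ι] {x y : ι → ℂ} (h : ∀ v, ‖x v‖ ≤ ‖y v‖) :
    ‖WithLp.toLp 2 x‖ ≤ ‖WithLp.toLp 2 y‖ := by
  rw [EuclideanSpace.norm_eq, EuclideanSpace.norm_eq]
  exact Real.sqrt_le_sqrt (Finset.sum_le_sum fun v _ => pow_le_pow_left₀ (norm_nonneg _) (h v) 2)

lemma EuclideanSpace.norm_dotProduct_le {ι : Type*} [Fintype ι] (x y : ι → ℂ) :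
    ‖x ⬝ᵥ y‖ ≤ ‖WithLp.toLp 2 x‖ * ‖WithLp.toLp 2 y‖ := by
  have := norm_inner_le_norm (𝕜 := ℂ) (WithLp.toLp 2 (star y) : EuclideanSpace ℂ ι)
    (WithLp.toLp 2 x)
  rw [EuclideanSpace.inner_eq_star_dotProduct, mul_comm] at this
  have h2 : ‖WithLp.toLp 2 (star y)‖ ≤ ‖WithLp.toLp 2 y‖ :=
    EuclideanSpace.norm_toLp_le fun v => by simp
  simp only [star_star] at this
  exact this.trans (mul_le_mul_of_nonneg_left h2 (norm_nonneg _))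

open Matrix in
lemma Matrix.norm_toLp_unitary_row {ι : Type*} [Fintype ι] [DecidableEq ι] {U : Matrix ι ι ℂ}
    (hU : U ∈ unitary (Matrix ι ι ℂ)) (k : ι) : ‖WithLp.toLp 2 (U k)‖ ≤ 1 := by
  have h := norm_toLp_unitary_mulVec (Unitary.star_mem hU) (Pi.single k 1)
  rw [PiLp.toLp_single, PiLp.norm_single, norm_one, mulVec_single_one] at h
  rw [← h]
  exact EuclideanSpace.norm_toLp_le fun v => by simp [star_eq_conjTranspose]

/-- A Floquet frame diagonalizes the Hermitian periodic system `x' = -i A x`. -/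
structure IsFloquetFrame {ι : Type*} [Fintype ι] [DecidableEq ι] (A : ℝ → Matrix ι ι ℂ)
    (E : ι → ℝ) (G : ℝ → Matrix ι ι ℂ) : Prop where
  hermitian : ∀ t, (A t).IsHermitian
  mem_unitary : ∀ t, G t ∈ unitary (Matrix ι ι ℂ)
  hasDerivAt : ∀ k v t, HasDerivAt (fun t => G t k v)
    (-Complex.I * ((A t * G t) k v - E v * G t k v)) t

namespace IsFloquetFrame

open Matrix

variable {ι : Type*} [Fintype ι] [DecidableEq ι] {A : ℝ → Matrix ι ι ℂ} {E : ι → ℝ}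
  {G : ℝ → Matrix ι ι ℂ} {x f : ℝ → ι → ℂ}

/-- In the interaction picture only the source term drives the coefficients. -/
lemma hasDerivAt_coeff (h : IsFloquetFrame A E G)
    (hx : ∀ k t, HasDerivAt (fun t => x t k) (-Complex.I * ((A t *ᵥ x t) k + f t k)) t)
    (v : ι) (t : ℝ) :
    HasDerivAt (fun t : ℝ => Complex.exp (Complex.I * E v * t) * ((G t)ᴴ *ᵥ x t) v)
      (-Complex.I * (Complex.exp (Complex.I * E v * t) * ((G t)ᴴ *ᵥ f t) v)) t := by
  have h1 : HasDerivAt (fun t => ((G t)ᴴ *ᵥ x t) v)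
      (∑ k, (star (-Complex.I * ((A t * G t) k v - E v * G t k v)) * x t k +
        star (G t k v) * (-Complex.I * ((A t *ᵥ x t) k + f t k)))) t := by
    simp only [mulVec, dotProduct, conjTranspose_apply]
    exact HasDerivAt.fun_sum fun k _ => (h.hasDerivAt k v t).star.mul (hx k t)
  have h3 : HasDerivAt (fun t : ℝ => Complex.exp (Complex.I * E v * t))
      (Complex.exp (Complex.I * E v * t) * (Complex.I * E v)) t := by
    have := ((hasDerivAt_id (t : ℂ)).const_mul (Complex.I * E v)).cexp.comp_ofReal
    simpa using this
  refine (h3.mul h1).congr_deriv ?_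
  have e1 : ∑ k, star ((A t * G t) k v) * x t k = ∑ k, star (G t k v) * (A t *ᵥ x t) k := by
    have : (((A t * G t)ᴴ) *ᵥ x t) v = ((G t)ᴴ *ᵥ (A t *ᵥ x t)) v := by
      rw [conjTranspose_mul, h.hermitian, mulVec_mulVec]
    exact this
  have e2 : (∑ k, (star (-Complex.I * ((A t * G t) k v - E v * G t k v)) * x t k +
        star (G t k v) * (-Complex.I * ((A t *ᵥ x t) k + f t k)))) =
      Complex.I * (∑ k, star ((A t * G t) k v) * x t k - E v * ((G t)ᴴ *ᵥ x t) v) -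
      Complex.I * (∑ k, star (G t k v) * (A t *ᵥ x t) k + ((G t)ᴴ *ᵥ f t) v) := by
    have g : ∀ y : ι → ℂ, ((G t)ᴴ *ᵥ y) v = ∑ k, star (G t k v) * y k := fun _ => rfl
    rw [g, g]
    simp only [Finset.mul_sum, ← Finset.sum_add_distrib, ← Finset.sum_sub_distrib]
    refine Finset.sum_congr rfl fun k _ => ?_
    generalize (A t * G t) k v = w
    simp only [star_mul', star_neg, star_sub, Complex.star_def, Complex.conj_I, Complex.conj_ofReal]
    ring
  rw [e2, e1]
  ring

lemma norm_coeff_sub_le (h : IsFloquetFrame A E G)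
    (hx : ∀ k t, HasDerivAt (fun t => x t k) (-Complex.I * ((A t *ᵥ x t) k + f t k)) t)
    {t M : ℝ} (hM : ∀ s, |s| ≤ |t| → ‖WithLp.toLp 2 (f s)‖ ≤ M) :
    ‖WithLp.toLp 2 (fun v => Complex.exp (Complex.I * E v * t) * ((G t)ᴴ *ᵥ x t) v) -
      WithLp.toLp 2 ((G 0)ᴴ *ᵥ x 0)‖ ≤ M * |t| := by
  set α : ℝ → EuclideanSpace ℂ ι := fun t : ℝ =>
    WithLp.toLp 2 (fun v => Complex.exp (Complex.I * E v * t) * ((G t)ᴴ *ᵥ x t) v) with hα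
  have hd : ∀ t : ℝ, HasDerivAt α (WithLp.toLp 2 fun v =>
      -Complex.I * (Complex.exp (Complex.I * E v * t) * ((G t)ᴴ *ᵥ f t) v)) t := by
    intro t
    exact (PiLp.continuousLinearEquiv 2 ℝ (fun _ : ι => ℂ)).symm.hasFDerivAt.comp_hasDerivAt t
      (hasDerivAt_pi.2 fun v => h.hasDerivAt_coeff hx v t)
  have hu : ∀ s, (G s)ᴴ ∈ unitary (Matrix ι ι ℂ) := fun s => Unitary.star_mem (h.mem_unitary s)
  have := Convex.norm_image_sub_le_of_norm_hasDerivWithin_le (f := α) (C := M)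
    (s := Set.Icc (-|t|) |t|) (fun s _ => (hd s).hasDerivWithinAt) (fun s hs => ?_)
    (convex_Icc _ _) (x := 0) (y := t) (by simp) (abs_le.1 le_rfl)
  · simpa [hα] using this
  · refine le_trans ?_ (hM s (abs_le.2 hs))
    rw [← norm_toLp_unitary_mulVec (hu s) (f s)]
    exact EuclideanSpace.norm_toLp_le fun v => by simp [Complex.norm_exp]

/-- Splitting a forced solution according to the quasi-energy. -/
lemma exists_split (h : IsFloquetFrame A E G)
    (hx : ∀ k t, HasDerivAt (fun t => x t k) (-Complex.I * ((A t *ᵥ x t) k + f t k)) t)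
    {t M : ℝ} (hM : ∀ s, |s| ≤ |t| → ‖WithLp.toLp 2 (f s)‖ ≤ M) (p : ι → Prop) [DecidablePred p]
    (K : Finset ι) :
    ∃ y z : ι → ℂ, x t = y + z ∧
      ‖WithLp.toLp 2 y‖ ≤ ‖WithLp.toLp 2 (fun k => if k ∈ K then 0 else x 0 k)‖ +
        ∑ k ∈ K, ‖x 0 k‖ * ‖WithLp.toLp 2 (fun v => if p v then G 0 k v else 0)‖ + M * |t| ∧
      ∀ k, ‖z k‖ ≤ ‖WithLp.toLp 2 (fun v => if p v then 0 else G t k v)‖ * ‖WithLp.toLp 2 (x t)‖ := by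
  have hu : ∀ s, (G s)ᴴ ∈ unitary (Matrix ι ι ℂ) := fun s => Unitary.star_mem (h.mem_unitary s)
  set β := (G t)ᴴ *ᵥ x t with hβ
  set β₀ := (G 0)ᴴ *ᵥ x 0 with hβ₀
  refine ⟨G t *ᵥ fun v => if p v then β v else 0, fun k => (fun v => if p v then 0 else G t k v) ⬝ᵥ β,
    ?_, ?_, fun k => ?_⟩
  · have : x t = G t *ᵥ β := by
      have : G t * (G t)ᴴ = 1 := (h.mem_unitary t).2
      rw [hβ, mulVec_mulVec, this, one_mulVec]
    conv_lhs => rw [this]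
    ext k
    simp only [Pi.add_apply, mulVec, dotProduct, ← Finset.sum_add_distrib]
    refine Finset.sum_congr rfl fun v _ => ?_
    split_ifs <;> simp
  · rw [norm_toLp_unitary_mulVec (h.mem_unitary t)]
    have h1 : ‖WithLp.toLp 2 fun v => if p v then β v else 0‖ ≤
        ‖WithLp.toLp 2 fun v => if p v then β₀ v else 0‖ + M * |t| := by
      have a := h.norm_coeff_sub_le hx hM
      rw [← WithLp.toLp_sub] at a
      have b : ‖WithLp.toLp 2 fun v => if p v then β v else 0‖ ≤
        ‖WithLp.toLp 2 fun v => if p v then Complex.exp (Complex.I * E v * t) * β v else 0‖ :=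
        EuclideanSpace.norm_toLp_le fun v => by split_ifs <;> simp [Complex.norm_exp]
      refine b.trans ((norm_le_norm_add_norm_sub' _
        (WithLp.toLp 2 fun v => if p v then β₀ v else 0)).trans ?_)
      rw [← WithLp.toLp_sub]
      refine add_le_add_right (le_trans (EuclideanSpace.norm_toLp_le fun v => ?_) a) _
      simp only [Pi.sub_apply]
      split_ifs <;> simp [hβ, hβ₀]
    refine h1.trans (add_le_add_left ?_ _)
    have h2 : (fun v => if p v then β₀ v else 0) =
        (fun v => if p v then ((G 0)ᴴ *ᵥ fun k => if k ∈ K then 0 else x 0 k) v else 0) +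
        ∑ k ∈ K, x 0 k • star (fun v => if p v then G 0 k v else 0) := by
      ext v
      simp only [Pi.add_apply, Finset.sum_apply, Pi.smul_apply, Pi.star_apply]
      split_ifs with hv
      · simp only [hβ₀, mulVec, dotProduct, mul_ite, mul_zero, conjTranspose_apply, smul_eq_mul]
        have : ∑ k ∈ K, x 0 k * star (G 0 k v) =
            ∑ k, if k ∈ K then x 0 k * star (G 0 k v) else 0 := by simp
        rw [this, ← Finset.sum_add_distrib]
        refine Finset.sum_congr rfl fun k _ => ?_
        split_ifs <;> simp [mul_comm]
      · simp
    rw [h2, WithLp.toLp_add, WithLp.toLp_sum]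
    refine (norm_add_le _ _).trans (add_le_add ?_ ((norm_sum_le _ _).trans
      (Finset.sum_le_sum fun k _ => ?_)))
    · rw [← norm_toLp_unitary_mulVec (hu 0) fun k => if k ∈ K then 0 else x 0 k]
      exact EuclideanSpace.norm_toLp_le fun v => by split_ifs <;> simp
    · rw [WithLp.toLp_smul, norm_smul]
      exact mul_le_mul_of_nonneg_left (EuclideanSpace.norm_toLp_le fun v => (norm_star _).le)
        (norm_nonneg _)
  · rw [← norm_toLp_unitary_mulVec (hu t) (x t)]
    exact EuclideanSpace.norm_dotProduct_le _ _

end IsFloquetFrame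

/-- Bond weights equal to `1` on `[-N, N]` and vanishing outside `(-2N, 2N)`. -/
def taper (N : ℕ) (k : ℤ) : ℝ := √(max 0 (min 1 (2 - |(k : ℝ)| / N)))

lemma taper_nonneg (N : ℕ) (k : ℤ) : 0 ≤ taper N k := Real.sqrt_nonneg _

lemma taper_le_one (N : ℕ) (k : ℤ) : taper N k ≤ 1 :=
  Real.sqrt_le_one.2 (max_le zero_le_one (min_le_left _ _))

lemma taper_eq_one {N : ℕ} {k : ℤ} (hk : |k| ≤ N) : taper N k = 1 := by
  have h : |(k : ℝ)| / N ≤ 1 := div_le_one_of_le₀ (by exact_mod_cast hk) N.cast_nonneg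
  rw [taper, min_eq_left (by linarith), max_eq_right zero_le_one, Real.sqrt_one]

lemma taper_eq_zero {N : ℕ} (hN : 0 < N) {k : ℤ} (hk : 2 * (N : ℤ) ≤ |k|) : taper N k = 0 := by
  have hN' : (0 : ℝ) < N := by exact_mod_cast hN
  have h : 2 ≤ |(k : ℝ)| / N := by
    rw [le_div_iff₀ hN']
    exact_mod_cast hk
  rw [taper, min_eq_right (by linarith), max_eq_left (by linarith), Real.sqrt_zero]

lemma abs_taper_sq_sub_le {N : ℕ} (hN : 0 < N) (k : ℤ) :
    |taper N (k + 1) ^ 2 - taper N k ^ 2| * |(k : ℝ)| ≤ 3 := by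
  have hN' : (0 : ℝ) < N := by exact_mod_cast hN
  by_cases hk : 2 * (N : ℤ) < |k|
  · rw [taper_eq_zero hN hk.le, taper_eq_zero hN]
    · simp
    · have := abs_sub_abs_le_abs_sub k (k + 1)
      simp only [sub_add_cancel_left, abs_neg, abs_one] at this
      omega
  · have hk' : |(k : ℝ)| ≤ 2 * N := by exact_mod_cast not_lt.1 hk
    have h1 : |taper N (k + 1) ^ 2 - taper N k ^ 2| ≤ 1 / N := by
      rw [taper, taper, Real.sq_sqrt (le_max_left _ _), Real.sq_sqrt (le_max_left _ _)]
      refine (abs_max_sub_max_le_max _ _ _ _).trans (max_le (by simp) ?_)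
      refine (abs_min_sub_min_le_max _ _ _ _).trans (max_le (by simp) ?_)
      rw [sub_sub_sub_cancel_left, ← sub_div, abs_div, abs_of_pos hN', abs_sub_comm]
      have := abs_abs_sub_abs_le (((k + 1 : ℤ)) : ℝ) (k : ℝ)
      push_cast at this ⊢
      rw [add_sub_cancel_left, abs_one] at this
      gcongr
    calc _ ≤ 1 / N * (2 * (N : ℝ)) := mul_le_mul h1 hk' (abs_nonneg _) (by positivity)
      _ = 2 := by field_simp
      _ ≤ 3 := by norm_num

/-- The tapered Hamiltonian on `[-2N, 2N]`. -/
def truncMatrix (δ : ℝ) (N : ℕ) (t : ℝ) :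
    Matrix (Finset.Icc (-(2 * N) : ℤ) (2 * N)) (Finset.Icc (-(2 * N) : ℤ) (2 * N)) ℂ :=
  fun j k => (if (k : ℤ) = j then ((j : ℤ) : ℂ) ^ 2 else 0) + (δ : ℂ) * (Real.cos t : ℂ) *
    ((if (k : ℤ) = j - 1 then (taper N j : ℂ) else 0) +
      (if (k : ℤ) = j + 1 then (taper N (j + 1) : ℂ) else 0))

lemma continuous_truncMatrix (δ : ℝ) (N : ℕ) : Continuous (truncMatrix δ N) := by
  refine continuous_pi fun j => continuous_pi fun k => ?_
  simp only [truncMatrix]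
  fun_prop

lemma periodic_truncMatrix (δ : ℝ) (N : ℕ) :
    Function.Periodic (truncMatrix δ N) (2 * Real.pi) := by
  intro t
  ext j k
  simp [truncMatrix]

lemma isHermitian_truncMatrix (δ : ℝ) (N : ℕ) (t : ℝ) : (truncMatrix δ N t).IsHermitian := by
  ext j k
  obtain ⟨j, hj⟩ := j
  obtain ⟨k, hk⟩ := k
  simp only [Matrix.conjTranspose_apply, truncMatrix, star_add, star_mul', Complex.star_def,
    Complex.conj_ofReal, apply_ite (starRingEnd ℂ), map_zero, map_pow, map_intCast]
  rcases lt_trichotomy j k with h | rfl | h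
  · by_cases h' : k = j + 1
    · subst h'
      simp [show ¬ j = j + 1 + 1 by omega, show ¬ j + 1 = j - 1 by omega]
    · rw [if_neg (by omega), if_neg (by omega), if_neg (by omega), if_neg (by omega),
        if_neg (by omega), if_neg (by omega)]
  · simp
  · by_cases h' : j = k + 1
    · subst h'
      simp [show ¬ k = k + 1 + 1 by omega, show ¬ k + 1 = k - 1 by omega]
    · rw [if_neg (by omega), if_neg (by omega), if_neg (by omega), if_neg (by omega),
        if_neg (by omega), if_neg (by omega)]

open Matrix in
lemma truncMatrix_mulVec (δ : ℝ) {N : ℕ} (hN : 0 < N) (t : ℝ) (y : ℤ → ℂ)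
    (j : Finset.Icc (-(2 * N) : ℤ) (2 * N)) :
    (truncMatrix δ N t *ᵥ fun k => y k) j = ((j : ℤ) : ℂ) ^ 2 * y j + (δ : ℂ) * (Real.cos t : ℂ) *
      ((taper N j : ℂ) * y (j - 1) + (taper N (j + 1) : ℂ) * y (j + 1)) := by
  obtain ⟨j, hj⟩ := j
  have hj' := Finset.mem_Icc.1 hj
  have key : ∀ (m : ℤ) (a : ℂ), (m ∉ Finset.Icc (-(2 * N) : ℤ) (2 * N) → a = 0) →
      ∑ k : Finset.Icc (-(2 * N) : ℤ) (2 * N), (if (k : ℤ) = m then a else 0) * y k = a * y m := by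
    intro m a ha
    rw [Finset.sum_coe_sort (Finset.Icc (-(2 * N) : ℤ) (2 * N))
      (fun k => (if k = m then a else 0) * y k)]
    simp only [ite_mul, zero_mul, Finset.sum_ite_eq']
    split_ifs with h
    · rfl
    · rw [ha h, zero_mul]
  simp only [mulVec, dotProduct, truncMatrix, add_mul, mul_assoc, Finset.sum_add_distrib,
    ← Finset.mul_sum]
  rw [key, key, key]
  · intro h
    rw [taper_eq_zero hN, Complex.ofReal_zero]
    have : 2 * (N : ℤ) < j + 1 := by
      by_contra h'
      exact h (Finset.mem_Icc.2 (by omega))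
    exact this.le.trans (le_abs_self _)
  · intro h
    rw [taper_eq_zero hN, Complex.ofReal_zero]
    have : j ≤ -(2 * (N : ℤ)) := by
      by_contra h'
      exact h (Finset.mem_Icc.2 (by omega))
    exact (le_neg_of_le_neg this).trans (neg_le_abs _)
  · exact fun h => (h hj).elim

open Matrix in
/-- Multiplication by a real function on Euclidean space. -/
def diagonalCLM {ι : Type*} [Fintype ι] [DecidableEq ι] (e : ι → ℝ) :
    EuclideanSpace ℂ ι →L[ℂ] EuclideanSpace ℂ ι :=
  toEuclideanCLM (n := ι) (𝕜 := ℂ) (diagonal fun v => (e v : ℂ))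

open Matrix in
lemma diagonalCLM_apply {ι : Type*} [Fintype ι] [DecidableEq ι] (e : ι → ℝ)
    (x : EuclideanSpace ℂ ι) (v : ι) : diagonalCLM e x v = e v * x v := by
  rw [diagonalCLM, ofLp_toEuclideanCLM, mulVec_diagonal]

lemma norm_diagonalCLM_le {ι : Type*} [Fintype ι] [DecidableEq ι] {e : ι → ℝ} {a : ℝ}
    (h : ∀ v, |e v| ≤ a) (ha : 0 ≤ a) (x : EuclideanSpace ℂ ι) : ‖diagonalCLM e x‖ ≤ a * ‖x‖ := by
  have h1 : ‖(a : ℂ) • x‖ = a * ‖x‖ := by rw [norm_smul]; simp [abs_of_nonneg ha]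
  rw [← h1]
  refine EuclideanSpace.norm_toLp_le (x := fun v => diagonalCLM e x v)
    (y := fun v => ((a : ℂ) • x) v) fun v => ?_
  rw [diagonalCLM_apply, PiLp.smul_apply, norm_mul, norm_smul]
  simp only [Complex.norm_real, Real.norm_eq_abs, abs_of_nonneg ha]
  exact mul_le_mul_of_nonneg_right (h v) (norm_nonneg _)

lemma le_norm_diagonalCLM {ι : Type*} [Fintype ι] [DecidableEq ι] {e : ι → ℝ} {a : ℝ}
    (h : ∀ v, a ≤ |e v|) (ha : 0 ≤ a) (x : EuclideanSpace ℂ ι) : a * ‖x‖ ≤ ‖diagonalCLM e x‖ := by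
  have h1 : ‖(a : ℂ) • x‖ = a * ‖x‖ := by rw [norm_smul]; simp [abs_of_nonneg ha]
  rw [← h1]
  refine EuclideanSpace.norm_toLp_le (y := fun v => diagonalCLM e x v)
    (x := fun v => ((a : ℂ) • x) v) fun v => ?_
  rw [diagonalCLM_apply, PiLp.smul_apply, norm_mul, norm_smul]
  simp only [Complex.norm_real, Real.norm_eq_abs, abs_of_nonneg ha]
  exact mul_le_mul_of_nonneg_right (h v) (norm_nonneg _)

/-- The rows of a Floquet frame, restricted to the quasi-energies selected by `p` and extended
by zero. -/
def frameRow {N : ℕ} (G : ℝ → Matrix (Finset.Icc (-(2 * N) : ℤ) (2 * N))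
      (Finset.Icc (-(2 * N) : ℤ) (2 * N)) ℂ)
    (p : Finset.Icc (-(2 * N) : ℤ) (2 * N) → Prop) [DecidablePred p] (k : ℤ) (t : ℝ) :
    EuclideanSpace ℂ (Finset.Icc (-(2 * N) : ℤ) (2 * N)) :=
  if h : k ∈ Finset.Icc (-(2 * N) : ℤ) (2 * N) then
    WithLp.toLp 2 fun v => if p v then G t ⟨k, h⟩ v else 0
  else 0

lemma frameRow_coe {N : ℕ} (G : ℝ → Matrix (Finset.Icc (-(2 * N) : ℤ) (2 * N))
      (Finset.Icc (-(2 * N) : ℤ) (2 * N)) ℂ)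
    (p : Finset.Icc (-(2 * N) : ℤ) (2 * N) → Prop) [DecidablePred p]
    (k : Finset.Icc (-(2 * N) : ℤ) (2 * N)) (t : ℝ) :
    frameRow G p k t = WithLp.toLp 2 fun v => if p v then G t k v else 0 :=
  dif_pos k.2

lemma frameRow_of_lt {N : ℕ} (G : ℝ → Matrix (Finset.Icc (-(2 * N) : ℤ) (2 * N))
      (Finset.Icc (-(2 * N) : ℤ) (2 * N)) ℂ)
    (p : Finset.Icc (-(2 * N) : ℤ) (2 * N) → Prop) [DecidablePred p]
    {k : ℤ} (hk : 2 * (N : ℤ) < |k|) : frameRow G p k = 0 := by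
  ext1 t
  refine dif_neg fun h => ?_
  have := Finset.mem_Icc.1 h
  exact absurd (abs_le.2 this) (not_le.2 hk)

lemma IsFloquetFrame.isFloquetFamily {δ : ℝ} {N : ℕ} (hN : 0 < N)
    {E : Finset.Icc (-(2 * N) : ℤ) (2 * N) → ℝ}
    {G : ℝ → Matrix (Finset.Icc (-(2 * N) : ℤ) (2 * N)) (Finset.Icc (-(2 * N) : ℤ) (2 * N)) ℂ}
    (h : IsFloquetFrame (truncMatrix δ N) E G) (hG : Function.Periodic G (2 * Real.pi))
    (p : Finset.Icc (-(2 * N) : ℤ) (2 * N) → Prop) [DecidablePred p]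
    {e : Finset.Icc (-(2 * N) : ℤ) (2 * N) → ℝ} (he : ∀ v, p v → e v = E v) :
    IsFloquetFamily δ (taper N) (diagonalCLM e) (frameRow G p) where
  periodic k t := by
    simp only [frameRow, hG t]
  norm_le_one k t := by
    by_cases hk : k ∈ Finset.Icc (-(2 * N) : ℤ) (2 * N)
    · rw [frameRow_coe G p ⟨k, hk⟩]
      refine le_trans (EuclideanSpace.norm_toLp_le fun v => ?_)
        (Matrix.norm_toLp_unitary_row (h.mem_unitary t) ⟨k, hk⟩)
      split_ifs <;> simp
    · simp [frameRow, hk]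
  hasDerivAt k t := by
    by_cases hk : k ∈ Finset.Icc (-(2 * N) : ℤ) (2 * N)
    · lift k to Finset.Icc (-(2 * N) : ℤ) (2 * N) using hk
      have hd : ∀ v, HasDerivAt (fun t => if p v then G t k v else 0)
          (if p v then -Complex.I * ((truncMatrix δ N t * G t) k v - E v * G t k v) else 0) t := by
        intro v
        split_ifs
        · exact h.hasDerivAt k v t
        · exact hasDerivAt_const _ _
      have hrow := (PiLp.continuousLinearEquiv 2 ℝ (fun _ : Finset.Icc (-(2 * N) : ℤ) (2 * N) =>
        ℂ)).symm.hasFDerivAt.comp_hasDerivAt t (hasDerivAt_pi.2 hd)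
      refine HasDerivAt.congr_deriv (f := frameRow G p k) (hrow.congr_of_eventuallyEq
        (.of_forall fun t => frameRow_coe G p k t)) ?_
      ext v
      have hmul : ∀ hv : p v, (truncMatrix δ N t * G t) k v = _ := fun hv =>
        calc (truncMatrix δ N t * G t) k v
            = truncMatrix δ N t k ⬝ᵥ fun j => (frameRow G p j t) v := by
              simp only [frameRow_coe, hv, if_true]
              rfl
          _ = _ := truncMatrix_mulVec δ hN t (fun j => frameRow G p j t v) k
      have hz : ¬ p v → ∀ j, frameRow G p j t v = 0 := by
        intro hv j
        by_cases hj : j ∈ Finset.Icc (-(2 * N) : ℤ) (2 * N)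
        · rw [frameRow_coe G p ⟨j, hj⟩]
          simp [hv]
        · simp [frameRow, hj]
      have hlhs : ((PiLp.continuousLinearEquiv 2 ℝ
          (fun _ : Finset.Icc (-(2 * N) : ℤ) (2 * N) => ℂ)).symm fun v =>
          if p v then -Complex.I * ((truncMatrix δ N t * G t) k v - E v * G t k v) else 0) v =
          if p v then -Complex.I * ((truncMatrix δ N t * G t) k v - E v * G t k v) else 0 := rfl
      refine hlhs.trans ?_
      simp only [PiLp.smul_apply, PiLp.add_apply, PiLp.sub_apply, diagonalCLM_apply, smul_eq_mul]
      split_ifs with hv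
      · have hG : G t k v = frameRow G p k t v := by
          rw [frameRow_coe]
          simp [hv]
        rw [hmul hv, hG, he v hv]
        ring
      · simp [hz hv]
    · have hk' : 2 * (N : ℤ) < |k| := by
        by_contra h'
        exact hk (Finset.mem_Icc.2 (abs_le.1 (not_lt.1 h')))
      have h1 : taper N k = 0 := taper_eq_zero hN hk'.le
      have h2 : taper N (k + 1) = 0 := taper_eq_zero hN (by
        have := abs_sub_abs_le_abs_sub k (k + 1)
        simp only [sub_add_cancel_left, abs_neg, abs_one] at this
        omega)
      rw [frameRow_of_lt G p hk', h1, h2]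
      simp

/-- The Fourier coefficients of a solution of the driven Schrödinger equation. -/
def IsFourierSolution (δ : ℝ) (c : ℤ → ℝ → ℂ) : Prop :=
  ∀ j t, HasDerivAt (c j) (-Complex.I * (((j : ℂ) ^ 2) * c j t +
    (δ : ℂ) * (Real.cos t : ℂ) * (c (j - 1) t + c (j + 1) t))) t

lemma sum_half_pow_natAbs_le (F : Finset ℤ) : ∑ k ∈ F, (1 / 2 : ℝ) ^ k.natAbs ≤ 3 := by
  have h1 : HasSum (fun n : ℕ => (1 / 2 : ℝ) ^ (n : ℤ).natAbs) 2 := by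
    simpa using hasSum_geometric_two
  have h2 : HasSum (fun n : ℕ => (1 / 2 : ℝ) ^ (-((n : ℤ) + 1)).natAbs) 1 := by
    have h := hasSum_geometric_two.mul_left (1 / 2 : ℝ)
    rw [show (1 / 2 : ℝ) * 2 = 1 by norm_num] at h
    refine h.congr_fun fun n => ?_
    rw [show (-((n : ℤ) + 1)).natAbs = n + 1 by omega, pow_succ']
  have h := HasSum.of_nat_of_neg_add_one (f := fun k : ℤ => (1 / 2 : ℝ) ^ k.natAbs) h1 h2
  have := sum_le_hasSum F (fun k _ => by positivity) h
  linarith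

lemma half_pow_toNat_sq_le {ℓ : ℕ} {k : ℤ} (hk : 200 * (ℓ : ℤ) ≤ |k|) :
    ((1 / 2 : ℝ) ^ (|k| - 40 * (2 * ℓ)).toNat) ^ 2 ≤ (1 / 2) ^ ℓ * (1 / 2) ^ k.natAbs := by
  rw [← pow_mul, ← pow_add]
  exact pow_le_pow_of_le_one (by norm_num) (by norm_num) (by
    rw [Int.abs_eq_natAbs] at hk ⊢
    omega)

lemma EuclideanSpace.norm_toLp_sq_eq {ι : Type*} [Fintype ι] (x : ι → ℂ) :
    ‖WithLp.toLp 2 x‖ ^ 2 = ∑ k, ‖x k‖ ^ 2 := by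
  rw [EuclideanSpace.norm_sq_eq]

lemma EuclideanSpace.norm_toLp_restrict_sq {F : Finset ℤ} (x : ℤ → ℂ) :
    ‖WithLp.toLp 2 (fun k : F => x k)‖ ^ 2 = ∑ k ∈ F, ‖x k‖ ^ 2 := by
  rw [EuclideanSpace.norm_toLp_sq_eq, Finset.sum_coe_sort F (fun k => ‖x k‖ ^ 2)]

/-- The part of the Hamiltonian discarded by tapering. -/
def taperSource (δ : ℝ) (c : ℤ → ℝ → ℂ) (N : ℕ) (t : ℝ) (k : ℤ) : ℂ :=
  (δ : ℂ) * (Real.cos t : ℂ) * ((1 - taper N k : ℝ) * c (k - 1) t +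
    (1 - taper N (k + 1) : ℝ) * c (k + 1) t)

lemma norm_one_sub_taper_mul_sq_le (N : ℕ) {k j : ℤ} (h : |k| ≤ |j| + 1) (z : ℂ) :
    ‖((1 - taper N k : ℝ) : ℂ) * z‖ ^ 2 ≤ if (N : ℤ) ≤ |j| then ‖z‖ ^ 2 else 0 := by
  split_ifs with hj
  · rw [norm_mul, Complex.norm_real, Real.norm_eq_abs,
      abs_of_nonneg (by linarith [taper_le_one N k])]
    refine pow_le_pow_left₀ (by have := taper_le_one N k; positivity) ?_ 2
    exact mul_le_of_le_one_left (norm_nonneg _) (by linarith [taper_nonneg N k])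
  · rw [taper_eq_one (by omega)]
    simp

lemma sum_norm_taperSource_sq_le {δ : ℝ} (hδ : |δ| ≤ 1) (c : ℤ → ℝ → ℂ) (N : ℕ) (t : ℝ) {μ : ℝ}
    (hμ : ∀ F : Finset ℤ, (∀ j ∈ F, (N : ℤ) ≤ |j|) → ∑ j ∈ F, ‖c j t‖ ^ 2 ≤ μ) (F : Finset ℤ) :
    ∑ k ∈ F, ‖taperSource δ c N t k‖ ^ 2 ≤ 4 * μ := by
  have key : ∀ e : ℤ ↪ ℤ,
      ∑ k ∈ F, (if (N : ℤ) ≤ |e k| then ‖c (e k) t‖ ^ 2 else 0) ≤ μ := by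
    intro e
    rw [← Finset.sum_map F e (fun j => if (N : ℤ) ≤ |j| then ‖c j t‖ ^ 2 else 0),
      ← Finset.sum_filter]
    exact hμ _ fun j hj => (Finset.mem_filter.1 hj).2
  have hb : ∀ k, ‖taperSource δ c N t k‖ ^ 2 ≤
      2 * (if (N : ℤ) ≤ |k - 1| then ‖c (k - 1) t‖ ^ 2 else 0) +
        2 * (if (N : ℤ) ≤ |k + 1| then ‖c (k + 1) t‖ ^ 2 else 0) := by
    intro k
    have h1 := norm_one_sub_taper_mul_sq_le N (k := k) (j := k - 1)
      (by have := abs_add_le (k - 1) 1; simpa using this) (c (k - 1) t)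
    have h2 := norm_one_sub_taper_mul_sq_le N (k := k + 1) (j := k + 1) (by omega) (c (k + 1) t)
    have h3 : ‖(δ : ℂ) * (Real.cos t : ℂ)‖ ≤ 1 := by
      rw [norm_mul, Complex.norm_real, Complex.norm_real]
      exact mul_le_one₀ hδ (norm_nonneg _) (Real.abs_cos_le_one t)
    have h4 : ‖taperSource δ c N t k‖ ≤ ‖((1 - taper N k : ℝ) : ℂ) * c (k - 1) t‖ +
        ‖((1 - taper N (k + 1) : ℝ) : ℂ) * c (k + 1) t‖ := by
      rw [taperSource, norm_mul]
      exact (mul_le_of_le_one_left (norm_nonneg _) h3).trans (norm_add_le _ _)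
    refine (pow_le_pow_left₀ (norm_nonneg _) h4 2).trans ((add_sq_le).trans ?_)
    linarith
  refine (Finset.sum_le_sum fun k _ => hb k).trans ?_
  rw [Finset.sum_add_distrib, ← Finset.mul_sum, ← Finset.mul_sum]
  have h1 : ∑ k ∈ F, (if (N : ℤ) ≤ |k - 1| then ‖c (k - 1) t‖ ^ 2 else 0) ≤ μ :=
    key (Equiv.subRight (1 : ℤ)).toEmbedding
  have h2 : ∑ k ∈ F, (if (N : ℤ) ≤ |k + 1| then ‖c (k + 1) t‖ ^ 2 else 0) ≤ μ :=
    key (Equiv.addRight (1 : ℤ)).toEmbedding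
  linarith

open Matrix in
/-- Up to exponentially small errors and the truncation source, mass outside `[-200ℓ, 200ℓ]` at
time `t` comes from mass outside `[-ℓ, ℓ]` at time `0`. -/
lemma IsFourierSolution.sum_high_le_of_source {δ : ℝ} {c : ℤ → ℝ → ℂ} (hc : IsFourierSolution δ c)
    (hδ : 0 < δ) (hδ' : δ ≤ 1 / 10000) {ℓ N : ℕ} (hℓ : 1 ≤ ℓ) (hN : 2 * ℓ + 3 ≤ N) {S a μ t : ℝ}
    (hS₀ : ∀ F : Finset ℤ, ∑ j ∈ F, ‖c j 0‖ ^ 2 ≤ S)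
    (hS : ∀ F : Finset ℤ, ∑ j ∈ F, ‖c j t‖ ^ 2 ≤ S)
    (ha : ∀ F : Finset ℤ, (∀ j ∈ F, (ℓ : ℤ) < |j|) → ∑ j ∈ F, ‖c j 0‖ ^ 2 ≤ a)
    (hμ : ∀ s, |s| ≤ |t| → ∀ F : Finset ℤ, (∀ j ∈ F, (N : ℤ) ≤ |j|) → ∑ j ∈ F, ‖c j s‖ ^ 2 ≤ μ)
    {F : Finset ℤ} (hF : ∀ j ∈ F, 200 * (ℓ : ℤ) ≤ |j| ∧ |j| ≤ 2 * N) :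
    ∑ j ∈ F, ‖c j t‖ ^ 2 ≤ 6 * a + 48 * (2 * ℓ + 1) ^ 2 * (1 / 2) ^ ℓ * S + 24 * μ * t ^ 2 := by
  have hN0 : 0 < N := by omega
  obtain ⟨E, G, hE, hG, hGp, hGd⟩ := Matrix.exists_floquet (continuous_truncMatrix δ N)
    (isHermitian_truncMatrix δ N) (periodic_truncMatrix δ N)
  have hfr : IsFloquetFrame (truncMatrix δ N) E G := ⟨isHermitian_truncMatrix δ N, hG, hGd⟩
  set η : ℝ := (δ / 2) ^ 2 / (2 * (((2 * ℓ : ℤ)) : ℝ) ^ 2) with hη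
  have hℓ' : (1 : ℝ) ≤ ℓ := by exact_mod_cast hℓ
  have hη0 : 0 ≤ η := by positivity
  have hη1 : η ≤ 1 / 2 := by
    rw [hη]
    push_cast
    rw [div_le_iff₀ (by positivity)]
    nlinarith
  classical
  set p : Finset.Icc (-(2 * N) : ℤ) (2 * N) → Prop := fun v => |E v| ≤ η with hp
  have hlo := hfr.isFloquetFamily hN0 hGp p (e := fun v => if p v then E v else 0)
    fun v hv => if_pos hv
  have hhi := hfr.isFloquetFamily hN0 hGp (fun v => ¬ p v) (e := fun v => if p v then 1 / 2 else E v)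
    fun v hv => if_neg hv
  have hzero : ∀ (q : Finset.Icc (-(2 * N) : ℤ) (2 * N) → Prop) [DecidablePred q] (k : ℤ),
      ((2 * N : ℕ) : ℤ) < |k| → frameRow G q k = 0 := fun q _ k hk =>
    frameRow_of_lt G q (by push_cast at hk; exact hk)
  have hlo' : ∀ k : ℤ, |k| ≤ ℓ → ‖frameRow G p k 0‖ ≤ 2 * (1 / 2) ^ ℓ := by
    intro k hk
    refine (hlo.norm_le_of_energy_le hδ hδ' (taper_nonneg N) (taper_le_one N)
      (norm_diagonalCLM_le (fun v => ?_) (by norm_num)) (hzero p) (L := 2 * ℓ) (by omega)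
      (fun j hj => taper_eq_one (by omega)) (norm_diagonalCLM_le (fun v => ?_) hη0) k 0).trans ?_
    · split_ifs
      · exact hE v
      · norm_num
    · split_ifs with hv
      · exact hv
      · rwa [abs_zero]
    · exact mul_le_mul_of_nonneg_left
        (pow_le_pow_of_le_one (by norm_num) (by norm_num) (by omega)) zero_le_two
  have hhi' : ∀ k : ℤ, 200 * (ℓ : ℤ) ≤ |k| →
      ‖frameRow G (fun v => ¬ p v) k t‖ ≤ 2 * (1 / 2) ^ (|k| - 40 * (2 * ℓ)).toNat := by
    intro k hk
    refine hhi.norm_le_of_le_energy hδ hδ' (taper_nonneg N) (taper_le_one N)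
      (norm_diagonalCLM_le (fun v => ?_) (by norm_num)) (hzero _) (L := 2 * ℓ) (by omega)
      (abs_taper_sq_sub_le hN0) (le_norm_diagonalCLM (fun v => ?_) hη0) k t
    · split_ifs
      · norm_num
      · exact hE v
    · split_ifs with hv
      · rwa [abs_of_pos (by norm_num)]
      · exact (not_le.1 hv).le
  have hx : ∀ (k : Finset.Icc (-(2 * N) : ℤ) (2 * N)) (s : ℝ), HasDerivAt (fun s => c k s)
      (-Complex.I * ((truncMatrix δ N s *ᵥ fun j => c j s) k + taperSource δ c N s k)) s := by
    intro k s
    rw [truncMatrix_mulVec δ hN0 s (fun j => c j s) k]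
    refine (hc k s).congr_deriv ?_
    rw [taperSource]
    push_cast
    ring
  have hμ0 : 0 ≤ μ := by simpa using hμ 0 (by simp) ∅ (by simp)
  have hS0 : 0 ≤ S := by simpa using hS ∅
  have hM : ∀ s, |s| ≤ |t| → ‖WithLp.toLp 2
      (fun k : Finset.Icc (-(2 * N) : ℤ) (2 * N) => taperSource δ c N s k)‖ ≤ 2 * √μ := by
    intro s hs
    refine (sq_le_sq₀ (norm_nonneg _) (by positivity)).1 ?_
    rw [EuclideanSpace.norm_toLp_restrict_sq, mul_pow, Real.sq_sqrt hμ0]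
    refine (sum_norm_taperSource_sq_le (abs_le.2 ⟨by linarith, by linarith⟩) c N s (hμ s hs)
      _).trans (by linarith)
  have hcS : ∀ k, ‖c k 0‖ ≤ √S := fun k => Real.le_sqrt_of_sq_le (by simpa using hS₀ {k})
  set K : Finset (Finset.Icc (-(2 * N) : ℤ) (2 * N)) :=
    Finset.univ.filter fun k => |(k : ℤ)| ≤ ℓ with hK
  obtain ⟨y, z, hyz, hy, hz⟩ := hfr.exists_split
    (x := fun s (k : Finset.Icc (-(2 * N) : ℤ) (2 * N)) => c k s)
    (f := fun s k => taperSource δ c N s k) hx hM p K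
  have hy1 : ‖WithLp.toLp 2 (fun k : Finset.Icc (-(2 * N) : ℤ) (2 * N) =>
      if k ∈ K then 0 else c k 0)‖ ≤ √a := by
    refine Real.le_sqrt_of_sq_le ?_
    have h := EuclideanSpace.norm_toLp_restrict_sq (F := Finset.Icc (-(2 * N) : ℤ) (2 * N))
      fun k => if |k| ≤ ℓ then 0 else c k 0
    simp only [hK, Finset.mem_filter_univ]
    rw [h]
    refine le_trans (le_of_eq ?_) (ha ((Finset.Icc (-(2 * N) : ℤ) (2 * N)).filter
      fun k => (ℓ : ℤ) < |k|) fun j hj => (Finset.mem_filter.1 hj).2)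
    rw [Finset.sum_filter]
    refine Finset.sum_congr rfl fun k _ => ?_
    by_cases h : |k| ≤ ℓ
    · rw [if_pos h, if_neg (not_lt.2 h)]
      simp
    · rw [if_neg h, if_pos (not_le.1 h)]
  have hy2 : ∑ k ∈ K, ‖c k 0‖ * ‖WithLp.toLp 2 (fun v => if p v then G 0 k v else 0)‖ ≤
      (2 * ℓ + 1) * (√S * (2 * (1 / 2) ^ ℓ)) := by
    have hcard : (K.card : ℝ) ≤ 2 * ℓ + 1 := by
      have h1 : K.card ≤ (Finset.Icc (-ℓ : ℤ) ℓ).card := by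
        refine Finset.card_le_card_of_injOn (fun k => (k : ℤ)) (fun k hk => ?_)
          Subtype.val_injective.injOn
        simpa [hK, abs_le] using hk
      rw [Int.card_Icc] at h1
      have h2 : K.card ≤ 2 * ℓ + 1 := by omega
      exact_mod_cast h2
    refine (Finset.sum_le_card_nsmul K _ (√S * (2 * (1 / 2) ^ ℓ)) fun k hk => ?_).trans ?_
    · have h := hlo' k (by simpa [hK] using hk)
      rw [frameRow_coe] at h
      exact mul_le_mul (hcS k) h (norm_nonneg _) (Real.sqrt_nonneg _)
    · rw [nsmul_eq_mul]
      exact mul_le_mul_of_nonneg_right hcard (by positivity)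
  have ha0 : 0 ≤ a := by simpa using ha ∅
  have hhalf : ((1 / 2 : ℝ) ^ ℓ) ^ 2 ≤ (1 / 2) ^ ℓ :=
    pow_le_of_le_one (by positivity) (pow_le_one₀ (by norm_num) (by norm_num)) two_ne_zero
  have hy3 : ‖WithLp.toLp 2 y‖ ^ 2 ≤
      3 * (a + 4 * (2 * ℓ + 1) ^ 2 * (1 / 2) ^ ℓ * S + 4 * μ * t ^ 2) := by
    have h := pow_le_pow_left₀ (norm_nonneg _)
      (hy.trans (add_le_add_left (add_le_add hy1 hy2) _)) 2
    refine h.trans ?_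
    set A := √a
    set B := (2 * (ℓ : ℝ) + 1) * (√S * (2 * (1 / 2) ^ ℓ)) with hB
    set C := 2 * √μ * |t| with hC
    have hA2 : A ^ 2 = a := Real.sq_sqrt ha0
    have hB2 : B ^ 2 ≤ 4 * (2 * ℓ + 1) ^ 2 * (1 / 2) ^ ℓ * S := by
      rw [hB, mul_pow, mul_pow, mul_pow, Real.sq_sqrt hS0]
      have := mul_le_mul_of_nonneg_left hhalf
        (by positivity : 0 ≤ 4 * (2 * (ℓ : ℝ) + 1) ^ 2 * S)
      linarith
    have hC2 : C ^ 2 = 4 * μ * t ^ 2 := by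
      rw [hC, mul_pow, mul_pow, Real.sq_sqrt hμ0, sq_abs]
      ring
    nlinarith [sq_nonneg (A - B), sq_nonneg (A - C), sq_nonneg (B - C)]
  have hxS : ‖WithLp.toLp 2 (fun k : Finset.Icc (-(2 * N) : ℤ) (2 * N) => c k t)‖ ^ 2 ≤ S := by
    rw [EuclideanSpace.norm_toLp_restrict_sq fun k => c k t]
    exact hS _
  have hz1 : ∀ k : Finset.Icc (-(2 * N) : ℤ) (2 * N), 200 * (ℓ : ℤ) ≤ |(k : ℤ)| →
      ‖z k‖ ^ 2 ≤ 4 * (1 / 2) ^ ℓ * S * (1 / 2) ^ (k : ℤ).natAbs := by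
    intro k hk
    have h := hhi' k hk
    rw [frameRow_coe] at h
    simp only [ite_not] at h
    have h1 := pow_le_pow_left₀ (norm_nonneg _)
      ((hz k).trans (mul_le_mul_of_nonneg_right h (norm_nonneg _))) 2
    rw [mul_pow, mul_pow] at h1
    refine h1.trans ((mul_le_mul (mul_le_mul_of_nonneg_left (half_pow_toNat_sq_le hk)
      (by norm_num)) hxS (by positivity) (by positivity)).trans (le_of_eq (by ring)))
  have hFsub : F ⊆ Finset.Icc (-(2 * N) : ℤ) (2 * N) := fun j hj =>
    Finset.mem_Icc.2 (abs_le.1 (hF j hj).2)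
  set F' : Finset (Finset.Icc (-(2 * N) : ℤ) (2 * N)) := F.subtype _ with hF'
  have hsum : ∀ g : ℤ → ℝ, ∑ j ∈ F, g j = ∑ k ∈ F', g k := fun g => by
    rw [hF', Finset.sum_subtype_of_mem g hFsub]
  calc ∑ j ∈ F, ‖c j t‖ ^ 2 = ∑ k ∈ F', ‖c k t‖ ^ 2 := hsum _
    _ ≤ ∑ k ∈ F', (2 * ‖y k‖ ^ 2 + 2 * (4 * (1 / 2) ^ ℓ * S * (1 / 2) ^ (k : ℤ).natAbs)) := by
      refine Finset.sum_le_sum fun k hk => ?_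
      have h1 : c k t = y k + z k := congrFun hyz k
      have h2 := hz1 k (hF k (Finset.mem_subtype.1 hk)).1
      rw [h1]
      refine (pow_le_pow_left₀ (norm_nonneg _) (norm_add_le _ _) 2).trans ((add_sq_le).trans ?_)
      linarith
    _ = 2 * ∑ k ∈ F', ‖y k‖ ^ 2 +
        8 * (1 / 2) ^ ℓ * S * ∑ j ∈ F, (1 / 2 : ℝ) ^ j.natAbs := by
      rw [hsum, Finset.sum_add_distrib, Finset.mul_sum, Finset.mul_sum]
      congr 1
      exact Finset.sum_congr rfl fun k _ => by ring
    _ ≤ 2 * (3 * (a + 4 * (2 * ℓ + 1) ^ 2 * (1 / 2) ^ ℓ * S + 4 * μ * t ^ 2)) +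
        8 * (1 / 2) ^ ℓ * S * 3 := by
      refine add_le_add (mul_le_mul_of_nonneg_left ?_ zero_le_two)
        (mul_le_mul_of_nonneg_left (sum_half_pow_natAbs_le F) (by positivity))
      rw [EuclideanSpace.norm_toLp_sq_eq] at hy3
      exact (Finset.sum_le_univ_sum_of_nonneg fun k => by positivity).trans hy3
    _ ≤ _ := by
      have h1 : (1 : ℝ) ≤ (2 * ℓ + 1) ^ 2 := one_le_pow₀ (by linarith)
      have h2 := mul_le_mul_of_nonneg_left h1 (by positivity : 0 ≤ (1 / 2 : ℝ) ^ ℓ * S)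
      linarith

open Set Filter Topology in
/-- Compactness upgrades local upper bounds to a bound on a compact set. -/
lemma IsCompact.exists_forall_le_of_eventually {X : Type*} [TopologicalSpace X] {f : X → ℝ}
    {K : Set X} (hK : IsCompact K) (h : ∀ x ∈ K, ∃ B, ∀ᶠ y in 𝓝 x, f y ≤ B) :
    ∃ B, ∀ x ∈ K, f x ≤ B := by
  refine hK.induction_on (p := fun K => ∃ B, ∀ x ∈ K, f x ≤ B) ⟨0, by simp⟩
    (fun s t hst ⟨B, hB⟩ => ⟨B, fun x hx => hB x (hst hx)⟩)
    (fun s t ⟨B, hB⟩ ⟨C, hC⟩ => ⟨max B C, fun x hx => ?_⟩) fun x hx => ?_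
  · rcases hx with hx | hx
    · exact (hB x hx).trans (le_max_left _ _)
    · exact (hC x hx).trans (le_max_right _ _)
  · obtain ⟨B, hB⟩ := h x hx
    exact ⟨_, mem_nhdsWithin_of_mem_nhds hB, B, fun _ hy => hy⟩

open Set Filter Topology in
/-- A function that is constant across intervals on which it is bounded, and is bounded at the
points of `F` between `x ∈ F` and `t`, is bounded at `t`, provided it is locally bounded off `F`. -/
lemma le_of_forall_mem_isClosed {S : ℝ → ℝ} {F : Set ℝ} (hF : IsClosed F)
    (hS : ∀ u t B, u ≤ t → (∀ τ ∈ Ioo u t, S τ ≤ B) → S u = S t)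
    (hloc : ∀ t ∉ F, ∃ B, ∀ᶠ τ in 𝓝 t, S τ ≤ B) {x t n : ℝ} (hx : x ∈ F) (hxt : x ≤ t)
    (hn : ∀ τ ∈ F, τ ∈ Icc x t → S τ ≤ n) : S t ≤ n := by
  have hne : (F ∩ Icc x t).Nonempty := ⟨x, hx, le_rfl, hxt⟩
  obtain ⟨a, ⟨haF, hax, hat⟩, ha⟩ := (isCompact_Icc.inter_left hF).exists_isGreatest hne
  have hoff : ∀ τ, a < τ → τ ≤ t → τ ∉ F := fun τ h1 h2 h3 =>
    absurd (ha ⟨h3, hax.trans h1.le, h2⟩) (not_le.2 h1)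
  have hconst : ∀ u ∈ Ioo a t, S u = S t := by
    intro u hu
    obtain ⟨B, hB⟩ := isCompact_Icc.exists_forall_le_of_eventually (f := S) (K := Icc u t)
      fun τ hτ => hloc τ (hoff τ (hu.1.trans_le hτ.1) hτ.2)
    exact hS u t B hu.2.le fun τ hτ => hB τ (Ioo_subset_Icc_self hτ)
  rw [← hS a t (S t) hat fun τ hτ => (hconst τ hτ).le]
  exact hn a haF ⟨hax, hat⟩

open Set Filter Topology in
/-- A lower semicontinuous function that is constant across intervals on which it is bounded is
constant. -/
lemma eq_of_forall_bounded_interval {S : ℝ → ℝ} (hlsc : ∀ n : ℕ, IsClosed {t | S t ≤ n})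
    (hS : ∀ u t B, u ≤ t → (∀ τ ∈ Ioo u t, S τ ≤ B) → S u = S t) (u t : ℝ) : S u = S t := by
  set F : Set ℝ := {t | ¬ ∃ B, ∀ᶠ τ in 𝓝 t, S τ ≤ B} with hFdef
  have hF : IsClosed F := by
    rw [← isOpen_compl_iff, isOpen_iff_eventually]
    intro t ht
    obtain ⟨B, hB⟩ := not_not.1 ht
    filter_upwards [eventually_eventually_nhds.2 hB] with τ hτ
    exact not_not.2 ⟨B, hτ⟩
  have hloc : ∀ t ∉ F, ∃ B, ∀ᶠ τ in 𝓝 t, S τ ≤ B := fun t ht => not_not.1 ht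
  have hempty : F = ∅ := by
    by_contra hne
    have hne' : Nonempty F := (nonempty_iff_ne_empty.2 hne).to_subtype
    have := hF.completeSpace_coe
    obtain ⟨n, ⟨x, hxF⟩, hx⟩ := nonempty_interior_of_iUnion_of_closed
      (f := fun n : ℕ => {t : F | S t ≤ n}) (fun n => (hlsc n).preimage continuous_subtype_val)
      (eq_univ_of_forall fun t => mem_iUnion.2 (exists_nat_ge (S t)))
    rw [mem_interior_iff_mem_nhds, Metric.mem_nhds_iff] at hx
    obtain ⟨r, hr, hxr⟩ := hx
    have hn : ∀ τ ∈ F, |τ - x| < r → S τ ≤ n := fun τ hτ h => @hxr ⟨τ, hτ⟩ h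
    refine hxF ⟨n, ?_⟩
    filter_upwards [Metric.ball_mem_nhds x hr] with t ht
    rw [Metric.mem_ball, Real.dist_eq] at ht
    rcases le_total x t with h | h
    · refine le_of_forall_mem_isClosed hF hS hloc hxF h fun τ hτ hτ' => hn τ hτ ?_
      rw [abs_of_nonneg (sub_nonneg.2 hτ'.1)]
      rw [abs_of_nonneg (sub_nonneg.2 h)] at ht
      linarith [hτ'.2]
    · have := le_of_forall_mem_isClosed (S := fun τ => S (-τ)) (F := (fun τ => -τ) ⁻¹' F)
        (hF.preimage continuous_neg) (fun u t B hut hB => (hS (-t) (-u) B (neg_le_neg hut)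
          fun τ hτ => by simpa using hB (-τ) ⟨lt_neg.1 hτ.2, neg_lt.1 hτ.1⟩).symm)
        (fun t ht => by
          obtain ⟨B, hB⟩ := hloc (-t) ht
          exact ⟨B, continuous_neg.continuousAt.eventually hB⟩)
        (x := -x) (t := -t) (n := n) (by simpa using hxF) (neg_le_neg h) (fun τ hτ hτ' => hn _ hτ ?_)
      · simpa using this
      · rw [abs_sub_comm] at ht ⊢
        rw [abs_of_nonneg (by linarith [hτ'.1])]
        rw [abs_of_nonneg (sub_nonneg.2 h)] at ht
        linarith [hτ'.2]
  wlog hut : u ≤ t generalizing u t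
  · exact (this t u (le_of_not_ge hut)).symm
  obtain ⟨B, hB⟩ := isCompact_Icc.exists_forall_le_of_eventually (f := S) (K := Icc u t)
    fun τ _ => hloc τ (by simp [hempty])
  exact hS u t B hut fun τ hτ => hB τ (Ioo_subset_Icc_self hτ)

/-- Summation by parts on a finite set containing the support of the weight. -/
lemma Finset.sum_mul_sub_shift (F : Finset ℤ) {φ : ℤ → ℝ} (hφ : ∀ j ∉ F, φ j = 0) (J : ℤ → ℝ) :
    ∑ j ∈ F, φ j * (J j - J (j - 1)) =
      ∑ j ∈ F ∪ F.map (Equiv.subRight (1 : ℤ)).toEmbedding, (φ j - φ (j + 1)) * J j := by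
  have h1 : ∑ j ∈ F, φ j * J j =
      ∑ j ∈ F ∪ F.map (Equiv.subRight (1 : ℤ)).toEmbedding, φ j * J j :=
    Finset.sum_subset Finset.subset_union_left fun j _ hj => by rw [hφ j hj, zero_mul]
  have h2 : ∑ j ∈ F, φ j * J (j - 1) =
      ∑ j ∈ F ∪ F.map (Equiv.subRight (1 : ℤ)).toEmbedding, φ (j + 1) * J j := by
    rw [← Finset.sum_subset (s₁ := F.map (Equiv.subRight (1 : ℤ)).toEmbedding)
      Finset.subset_union_right, Finset.sum_map]
    · simp
    · intro j _ hj
      rw [hφ (j + 1) fun h => hj (Finset.mem_map.2 ⟨j + 1, h, by simp⟩), zero_mul]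
  simp only [mul_sub, sub_mul, Finset.sum_sub_distrib, h1, h2]

namespace IsFourierSolution

variable {δ : ℝ} {c : ℤ → ℝ → ℂ}

/-- The probability current from site `j` to site `j + 1`, with sign. -/
def current (δ : ℝ) (c : ℤ → ℝ → ℂ) (t : ℝ) (j : ℤ) : ℝ :=
  2 * δ * Real.cos t * (starRingEnd ℂ (c j t) * c (j + 1) t).im

lemma hasDerivAt_norm_sq (hc : IsFourierSolution δ c) (j : ℤ) (t : ℝ) :
    HasDerivAt (fun t => ‖c j t‖ ^ 2) (current δ c t j - current δ c t (j - 1)) t := by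
  have h := (hc j t).norm_sq
  refine h.congr_deriv ?_
  rw [Complex.inner, current, current, sub_add_cancel]
  generalize Real.cos t = a
  simp [pow_two]
  ring

lemma abs_current_le (hδ : |δ| ≤ 1) (t : ℝ) (j : ℤ) :
    |current δ c t j| ≤ ‖c j t‖ ^ 2 + ‖c (j + 1) t‖ ^ 2 := by
  have h1 : |δ * Real.cos t| ≤ 1 := by
    rw [abs_mul]
    exact mul_le_one₀ hδ (abs_nonneg _) (Real.abs_cos_le_one t)
  have h2 : |(starRingEnd ℂ (c j t) * c (j + 1) t).im| ≤ ‖c j t‖ * ‖c (j + 1) t‖ := by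
    refine (Complex.abs_im_le_norm _).trans (le_of_eq ?_)
    rw [norm_mul, RCLike.norm_conj]
  calc |current δ c t j| = 2 * (|δ * Real.cos t| *
        |(starRingEnd ℂ (c j t) * c (j + 1) t).im|) := by
        rw [← abs_mul, ← abs_of_pos (zero_lt_two' ℝ), ← abs_mul,
          current]
        congr 1
        ring
    _ ≤ 2 * (1 * (‖c j t‖ * ‖c (j + 1) t‖)) := by gcongr
    _ ≤ _ := by nlinarith [sq_nonneg (‖c j t‖ - ‖c (j + 1) t‖)]

/-- The mass weighted with the Fejér kernel of width `N`. -/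
def fejerMass (c : ℤ → ℝ → ℂ) (N : ℕ) (t : ℝ) : ℝ :=
  ∑ j ∈ Finset.Icc (-N : ℤ) N, max 0 (1 - |(j : ℝ)| / N) * ‖c j t‖ ^ 2

lemma abs_fejerMass_sub_le (hc : IsFourierSolution δ c) (hδ : |δ| ≤ 1) {N : ℕ} (hN : 0 < N)
    (hs : ∀ t, Summable fun j => ‖c j t‖ ^ 2) {B u t : ℝ} (hut : u ≤ t)
    (hB : ∀ τ ∈ Set.Ioo u t, ∑' j, ‖c j τ‖ ^ 2 ≤ B) :
    |fejerMass c N t - fejerMass c N u| ≤ 2 * B * (t - u) / N := by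
  rcases hut.eq_or_lt with rfl | hut
  · simp
  have hN' : (0 : ℝ) < N := by exact_mod_cast hN
  set φ : ℤ → ℝ := fun j => max 0 (1 - |(j : ℝ)| / N) with hφ
  have hφ0 : ∀ j ∉ Finset.Icc (-N : ℤ) N, φ j = 0 := by
    intro j hj
    have h : (N : ℤ) ≤ |j| := by
      by_contra h'
      exact hj (Finset.mem_Icc.2 (abs_le.1 (not_le.1 h').le))
    have h' : (N : ℝ) ≤ |(j : ℝ)| := by exact_mod_cast h
    have h2 : 1 ≤ |(j : ℝ)| / N := (one_le_div hN').2 h'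
    exact max_eq_left (by linarith)
  have hφ1 : ∀ j, |φ j - φ (j + 1)| ≤ 1 / N := by
    intro j
    refine (abs_max_sub_max_le_max _ _ _ _).trans (max_le (by simp) ?_)
    rw [sub_sub_sub_cancel_left, ← sub_div, abs_div, abs_of_pos hN']
    have := abs_abs_sub_abs_le (((j + 1 : ℤ)) : ℝ) (j : ℝ)
    push_cast at this ⊢
    rw [add_sub_cancel_left, abs_one] at this
    gcongr
  have hd : ∀ τ, HasDerivAt (fejerMass c N)
      (∑ j ∈ Finset.Icc (-N : ℤ) N, φ j * (current δ c τ j - current δ c τ (j - 1))) τ :=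
    fun τ => HasDerivAt.fun_sum fun j _ => (hc.hasDerivAt_norm_sq j τ).const_mul (φ j)
  obtain ⟨τ, hτ, h⟩ := exists_hasDerivAt_eq_slope (fejerMass c N) _ hut
    (fun τ _ => (hd τ).continuousAt.continuousWithinAt) (fun τ _ => hd τ)
  rw [Finset.sum_mul_sub_shift _ hφ0, eq_div_iff (by linarith)] at h
  rw [← h, abs_mul, abs_of_pos (sub_pos.2 hut), mul_div_right_comm]
  refine mul_le_mul_of_nonneg_right ?_ (sub_pos.2 hut).le
  refine (Finset.abs_sum_le_sum_abs _ _).trans ?_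
  have hsum : ∀ (e : ℤ ↪ ℤ) (F : Finset ℤ), ∑ j ∈ F, ‖c (e j) τ‖ ^ 2 ≤ B := fun e F => by
    rw [← Finset.sum_map F e fun j => ‖c j τ‖ ^ 2]
    exact ((hs τ).sum_le_tsum _ fun j _ => by positivity).trans (hB τ hτ)
  calc _ ≤ ∑ j ∈ Finset.Icc (-N : ℤ) N ∪ (Finset.Icc (-N : ℤ) N).map
        (Equiv.subRight (1 : ℤ)).toEmbedding, 1 / N * (‖c j τ‖ ^ 2 + ‖c (j + 1) τ‖ ^ 2) := by
        refine Finset.sum_le_sum fun j _ => ?_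
        rw [abs_mul]
        exact mul_le_mul (hφ1 j) (abs_current_le hδ τ j) (abs_nonneg _) (by positivity)
    _ ≤ 1 / N * (B + B) := by
        rw [← Finset.mul_sum, Finset.sum_add_distrib]
        exact mul_le_mul_of_nonneg_left (add_le_add (hsum (.refl ℤ) _)
          (hsum (Equiv.addRight (1 : ℤ)).toEmbedding _)) (by positivity)
    _ = 2 * B / N := by ring

open Filter Topology in
lemma tendsto_fejerMass {t : ℝ} (hs : Summable fun j => ‖c j t‖ ^ 2) :
    Tendsto (fun N => fejerMass c N t) atTop (𝓝 (∑' j, ‖c j t‖ ^ 2)) := by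
  have h : ∀ N : ℕ, fejerMass c N t = ∑' j, (if j ∈ Finset.Icc (-N : ℤ) N then
      max 0 (1 - |(j : ℝ)| / N) * ‖c j t‖ ^ 2 else 0) := fun N => by
    rw [tsum_eq_sum (s := Finset.Icc (-N : ℤ) N) fun j hj => if_neg hj]
    exact Finset.sum_congr rfl fun j hj => (if_pos hj).symm
  simp only [h]
  refine tendsto_tsum_of_dominated_convergence hs (fun j => ?_) (.of_forall fun N j => ?_)
  · have h1 : Tendsto (fun N : ℕ => max 0 (1 - |(j : ℝ)| / N) * ‖c j t‖ ^ 2) atTop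
        (𝓝 (max 0 (1 - 0) * ‖c j t‖ ^ 2)) :=
      (tendsto_const_nhds.max (tendsto_const_nhds.sub
        (tendsto_const_div_atTop_nhds_zero_nat _))).mul_const _
    rw [sub_zero, max_eq_right zero_le_one, one_mul] at h1
    refine h1.congr' ?_
    filter_upwards [eventually_ge_atTop j.natAbs] with N hN
    rw [if_pos (Finset.mem_Icc.2 (by omega))]
  · have h1 : max 0 (1 - |(j : ℝ)| / N) ≤ 1 := max_le zero_le_one (by
      have : 0 ≤ |(j : ℝ)| / N := by positivity
      linarith)
    split_ifs
    · rw [Real.norm_of_nonneg (by positivity)]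
      exact mul_le_of_le_one_left (by positivity) h1
    · rw [norm_zero]
      positivity

open Filter Topology in
/-- Pointwise square summability already forces conservation of the `ℓ²` norm. -/
lemma tsum_norm_sq_eq (hc : IsFourierSolution δ c) (hδ : |δ| ≤ 1)
    (hs : ∀ t, Summable fun j => ‖c j t‖ ^ 2) (u t : ℝ) :
    ∑' j, ‖c j u‖ ^ 2 = ∑' j, ‖c j t‖ ^ 2 := by
  refine eq_of_forall_bounded_interval (S := fun t => ∑' j, ‖c j t‖ ^ 2) (fun n => ?_)
    (fun u t B hut hB => ?_) u t
  · have h : {t | ∑' j, ‖c j t‖ ^ 2 ≤ n} = ⋂ F : Finset ℤ, {t | ∑ j ∈ F, ‖c j t‖ ^ 2 ≤ n} := by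
      ext t
      simp only [Set.mem_iInter, Set.mem_ofPred_eq]
      exact ⟨fun h F => ((hs t).sum_le_tsum F fun j _ => by positivity).trans h,
        (hs t).tsum_le_of_sum_le⟩
    rw [h]
    exact isClosed_iInter fun F => isClosed_le (continuous_finsetSum _ fun j _ =>
      (continuous_iff_continuousAt.2 fun t => (hc j t).continuousAt).norm.pow 2) continuous_const
  · have h1 := ((tendsto_fejerMass (hs t)).sub (tendsto_fejerMass (hs u))).abs
    have h2 := le_of_tendsto_of_tendsto h1
      (tendsto_const_div_atTop_nhds_zero_nat (2 * B * (t - u))) (by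
        filter_upwards [eventually_gt_atTop 0] with N hN
        exact hc.abs_fejerMass_sub_le hδ hN hs hut hB)
    exact (sub_eq_zero.1 (abs_nonpos_iff.1 h2)).symm

lemma sum_add_fejerMass_le {N : ℕ} (hN : 0 < N) {t : ℝ} (hs : Summable fun j => ‖c j t‖ ^ 2)
    {F : Finset ℤ} (hF : ∀ j ∈ F, (N : ℤ) ≤ |j|) :
    ∑ j ∈ F, ‖c j t‖ ^ 2 + fejerMass c N t ≤ ∑' j, ‖c j t‖ ^ 2 := by
  have hN' : (0 : ℝ) < N := by exact_mod_cast hN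
  have h1 : fejerMass c N t ≤ ∑ j ∈ Finset.Icc (-N : ℤ) N \ F, ‖c j t‖ ^ 2 := by
    rw [fejerMass, ← Finset.sum_subset (Finset.sdiff_subset (t := F))]
    · refine Finset.sum_le_sum fun j _ => mul_le_of_le_one_left (by positivity)
        (max_le zero_le_one ?_)
      have : 0 ≤ |(j : ℝ)| / N := by positivity
      linarith
    · intro j hj hj'
      have h : (N : ℝ) ≤ |(j : ℝ)| := by
        exact_mod_cast hF j (by simpa [Finset.mem_sdiff, hj] using hj')
      have h2 : 1 ≤ |(j : ℝ)| / N := (one_le_div hN').2 h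
      rw [max_eq_left (by linarith), zero_mul]
  refine (add_le_add_right h1 _).trans ?_
  rw [← Finset.sum_union Finset.disjoint_sdiff]
  exact hs.sum_le_tsum _ fun j _ => by positivity

open Filter Topology in
/-- Up to exponentially small errors, mass outside `[-200ℓ, 200ℓ]` at any time comes from mass
outside `[-ℓ, ℓ]` at time `0`. -/
lemma sum_high_le (hc : IsFourierSolution δ c) (hδ : 0 < δ) (hδ' : δ ≤ 1 / 10000)
    (hs : ∀ t, Summable fun j => ‖c j t‖ ^ 2) {ℓ : ℕ} (hℓ : 1 ≤ ℓ) {a : ℝ}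
    (ha : ∀ F : Finset ℤ, (∀ j ∈ F, (ℓ : ℤ) < |j|) → ∑ j ∈ F, ‖c j 0‖ ^ 2 ≤ a) (t : ℝ)
    {F : Finset ℤ} (hF : ∀ j ∈ F, 200 * (ℓ : ℤ) ≤ |j|) :
    ∑ j ∈ F, ‖c j t‖ ^ 2 ≤
      6 * a + 48 * (2 * ℓ + 1) ^ 2 * (1 / 2) ^ ℓ * ∑' j, ‖c j 0‖ ^ 2 := by
  set S := ∑' j, ‖c j 0‖ ^ 2 with hS
  have hδ1 : |δ| ≤ 1 := abs_le.2 ⟨by linarith, by linarith⟩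
  have hSt : ∀ t, ∑' j, ‖c j t‖ ^ 2 = S := fun t => hc.tsum_norm_sq_eq hδ1 hs t 0
  have hSF : ∀ t (F : Finset ℤ), ∑ j ∈ F, ‖c j t‖ ^ 2 ≤ S := fun t F => by
    rw [← hSt t]
    exact (hs t).sum_le_tsum F fun j _ => by positivity
  have hS0 : 0 ≤ S := by simpa using hSF 0 ∅
  set μ : ℕ → ℝ := fun N => S - fejerMass c N 0 + 2 * S * |t| / N with hμdef
  have hμ : ∀ N : ℕ, 0 < N → ∀ s, |s| ≤ |t| → ∀ F : Finset ℤ, (∀ j ∈ F, (N : ℤ) ≤ |j|) →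
      ∑ j ∈ F, ‖c j s‖ ^ 2 ≤ μ N := by
    intro N hN s hst F hF
    have h1 := sum_add_fejerMass_le hN (hs s) hF
    rw [hSt s] at h1
    have h2 : |fejerMass c N s - fejerMass c N 0| ≤ 2 * S * |s| / N := by
      rcases le_total 0 s with h | h
      · rw [abs_of_nonneg h]
        simpa using hc.abs_fejerMass_sub_le hδ1 hN hs h fun τ _ => (hSt τ).le
      · rw [abs_of_nonpos h, abs_sub_comm]
        simpa using hc.abs_fejerMass_sub_le hδ1 hN hs h fun τ _ => (hSt τ).le
    have h3 : 2 * S * |s| / N ≤ 2 * S * |t| / N := by gcongr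
    have h4 := (abs_le.1 h2).1
    simp only [hμdef]
    linarith
  have hlim : Tendsto (fun N => 6 * a + 48 * (2 * ℓ + 1) ^ 2 * (1 / 2) ^ ℓ * S + 24 * μ N * t ^ 2)
      atTop (𝓝 (6 * a + 48 * (2 * ℓ + 1) ^ 2 * (1 / 2) ^ ℓ * S + 24 * (S - S + 0) * t ^ 2)) :=
    tendsto_const_nhds.add ((((tendsto_const_nhds.sub (tendsto_fejerMass (hs 0))).add
      (tendsto_const_div_atTop_nhds_zero_nat _)).const_mul _).mul_const _)
  rw [sub_self, add_zero, mul_zero, zero_mul, add_zero] at hlim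
  refine ge_of_tendsto hlim ?_
  filter_upwards [eventually_ge_atTop (2 * ℓ + 3), eventually_ge_atTop (F.sup Int.natAbs)]
    with N hN hN'
  refine hc.sum_high_le_of_source hδ hδ' hℓ hN (hSF 0) (hSF t) ha (hμ N (by omega))
    fun j hj => ⟨hF j hj, ?_⟩
  have := (Finset.le_sup (f := Int.natAbs) hj).trans hN'
  rw [Int.abs_eq_natAbs]
  omega

end IsFourierSolution

/-- Tail bounds with a summable error imply bounds for weighted sums. -/
lemma sum_weight_mul_le {w : ℕ → ℝ} (hw : Monotone w) (hw1 : ∀ n, 1 ≤ w n) {D : ℝ}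
    (hD : ∀ n, w (200 * n) ≤ D * w n) {g : ℕ → ℝ} (hg0 : ∀ n, 0 ≤ g n) {B : ℝ}
    (hB : ∀ M, ∑ i ∈ Finset.range M, w (200 * (i + 2)) * g (i + 1) ≤ B) {x y : ℤ → ℝ}
    (hx : ∀ k, 0 ≤ x k) (hy : ∀ k, 0 ≤ y k) (hwy : Summable fun k => w k.natAbs * y k)
    (hmass : ∀ F : Finset ℤ, ∑ k ∈ F, x k ≤ ∑' k, y k)
    (htail : ∀ ℓ : ℕ, 1 ≤ ℓ → ∀ F : Finset ℤ, (∀ k ∈ F, 200 * ℓ ≤ k.natAbs) →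
      ∑ k ∈ F, x k ≤ 6 * ∑' k : ℤ, (if ℓ < k.natAbs then y k else 0) + g ℓ * ∑' k, y k)
    (F : Finset ℤ) :
    ∑ k ∈ F, w k.natAbs * x k ≤ (w 200 + 6 * D + B) * ∑' k, w k.natAbs * y k := by
  set u : ℕ → ℝ := fun i => w (200 * (i + 1)) with hu
  have hu_mono : Monotone u := fun i j hij => hw (by omega)
  have hu0 : ∀ i, 0 ≤ u i := fun i => zero_le_one.trans (hw1 _)
  set M := F.sup Int.natAbs with hM
  have hys : Summable y := Summable.of_nonneg_of_le hy
    (fun k => le_mul_of_one_le_left (hy k) (hw1 _)) hwy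
  have hyW : ∑' k, y k ≤ ∑' k, w k.natAbs * y k :=
    hys.tsum_le_tsum (fun k => le_mul_of_one_le_left (hy k) (hw1 _)) hwy
  have hys0 : 0 ≤ ∑' k, y k := tsum_nonneg hy
  have hup : ∀ n ≤ M, w n ≤ w 200 +
      ∑ i ∈ Finset.range M, if 200 * (i + 1) ≤ n then u (i + 1) - u i else 0 := by
    intro n hn
    have hfil : (Finset.range M).filter (fun i => 200 * (i + 1) ≤ n) = Finset.range (n / 200) := by
      ext i
      simp only [Finset.mem_filter, Finset.mem_range]
      omega
    rw [← Finset.sum_filter, hfil, Finset.sum_range_sub]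
    have h : w n ≤ u (n / 200) := hw (by omega)
    have h2 : u 0 = w 200 := rfl
    linarith
  have hlow : ∀ n, ∑ i ∈ Finset.range M, (if i + 1 < n then u (i + 1) - u i else 0) ≤ D * w n := by
    intro n
    have hfil : (Finset.range M).filter (fun i => i + 1 < n) = Finset.range (min M (n - 1)) := by
      ext i
      simp only [Finset.mem_filter, Finset.mem_range]
      omega
    rw [← Finset.sum_filter, hfil, Finset.sum_range_sub]
    refine le_trans ?_ (hD n)
    rcases Nat.eq_zero_or_pos n with rfl | hn
    · simpa using zero_le_one.trans (hw1 0)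
    · have h : u (min M (n - 1)) ≤ w (200 * n) := hw (by
        have := min_le_right M (n - 1)
        omega)
      linarith [hu0 0]
  have hdiff : ∀ i, 0 ≤ u (i + 1) - u i := fun i => sub_nonneg.2 (hu_mono i.le_succ)
  have htails : ∑ i ∈ Finset.range M, (u (i + 1) - u i) *
      ∑' k : ℤ, (if i + 1 < k.natAbs then y k else 0) ≤ D * ∑' k, w k.natAbs * y k := by
    have hsm : ∀ i : ℕ, Summable fun k : ℤ =>
        (u (i + 1) - u i) * (if i + 1 < k.natAbs then y k else 0) := fun i =>
      (Summable.of_nonneg_of_le (fun k => by split_ifs <;> simp [hy])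
        (fun k => by split_ifs <;> simp [hy]) hys).mul_left _
    simp only [← tsum_mul_left]
    rw [← Summable.tsum_finsetSum fun i _ => hsm i]
    refine (summable_sum fun i _ => hsm i).tsum_le_tsum (fun k => ?_) (hwy.mul_left D)
    rw [← mul_assoc]
    refine le_trans (le_of_eq ?_) (mul_le_mul_of_nonneg_right (hlow k.natAbs) (hy k))
    rw [Finset.sum_mul]
    exact Finset.sum_congr rfl fun i _ => by split_ifs <;> simp
  calc ∑ k ∈ F, w k.natAbs * x k
      ≤ ∑ k ∈ F, (w 200 + ∑ i ∈ Finset.range M,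
          if 200 * (i + 1) ≤ k.natAbs then u (i + 1) - u i else 0) * x k :=
        Finset.sum_le_sum fun k hk =>
          mul_le_mul_of_nonneg_right (hup _ (Finset.le_sup hk)) (hx k)
    _ = w 200 * ∑ k ∈ F, x k + ∑ i ∈ Finset.range M, (u (i + 1) - u i) *
          ∑ k ∈ F.filter fun k => 200 * (i + 1) ≤ k.natAbs, x k := by
        simp only [add_mul, Finset.sum_add_distrib, Finset.sum_mul, ← Finset.mul_sum]
        congr 1
        rw [Finset.sum_comm]
        refine Finset.sum_congr rfl fun i _ => ?_
        rw [Finset.sum_filter, Finset.mul_sum]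
        exact Finset.sum_congr rfl fun k _ => by split_ifs <;> simp
    _ ≤ w 200 * ∑' k, y k + ∑ i ∈ Finset.range M, (u (i + 1) - u i) *
          (6 * ∑' k : ℤ, (if i + 1 < k.natAbs then y k else 0) + g (i + 1) * ∑' k, y k) := by
        refine add_le_add (mul_le_mul_of_nonneg_left (hmass F) (zero_le_one.trans (hw1 _)))
          (Finset.sum_le_sum fun i _ => mul_le_mul_of_nonneg_left (htail (i + 1) (by omega) _
            fun k hk => (Finset.mem_filter.1 hk).2) (hdiff i))
    _ = w 200 * ∑' k, y k + 6 * (∑ i ∈ Finset.range M, (u (i + 1) - u i) *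
          ∑' k : ℤ, (if i + 1 < k.natAbs then y k else 0)) +
          (∑ i ∈ Finset.range M, (u (i + 1) - u i) * g (i + 1)) * ∑' k, y k := by
        rw [Finset.mul_sum, Finset.sum_mul, add_assoc, ← Finset.sum_add_distrib]
        congr 1
        exact Finset.sum_congr rfl fun i _ => by ring
    _ ≤ w 200 * ∑' k, y k + 6 * (D * ∑' k, w k.natAbs * y k) + B * ∑' k, y k := by
        refine add_le_add (add_le_add_right (mul_le_mul_of_nonneg_left htails (by norm_num)) _)
          (mul_le_mul_of_nonneg_right ((Finset.sum_le_sum fun i _ => ?_).trans (hB M)) hys0)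
        exact mul_le_mul_of_nonneg_right (by
          have : u (i + 1) = w (200 * (i + 2)) := rfl
          linarith [hu0 i]) (hg0 _)
    _ ≤ _ := by
        have h1 := mul_le_mul_of_nonneg_left hyW (zero_le_one.trans (hw1 200))
        have h2 := mul_le_mul_of_nonneg_left hyW (by simpa using hB 0)
        linarith

/-- The Sobolev weight of frequency `n`. -/
def sobolevWeight (s : ℝ) (n : ℕ) : ℝ := (1 + (n : ℝ) ^ 2) ^ s

lemma one_le_sobolevWeight {s : ℝ} (hs : 0 ≤ s) (n : ℕ) : 1 ≤ sobolevWeight s n :=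
  Real.one_le_rpow (by nlinarith [sq_nonneg (n : ℝ)]) hs

lemma monotone_sobolevWeight {s : ℝ} (hs : 0 ≤ s) : Monotone (sobolevWeight s) := by
  intro m n hmn
  unfold sobolevWeight
  gcongr

lemma sobolevWeight_mul_le {s : ℝ} (hs : 0 ≤ s) (n : ℕ) :
    sobolevWeight s (200 * n) ≤ (200 ^ 2 : ℝ) ^ s * sobolevWeight s n := by
  unfold sobolevWeight
  rw [← Real.mul_rpow (by norm_num) (by positivity)]
  refine Real.rpow_le_rpow (by positivity) ?_ hs
  push_cast
  linarith

lemma summable_sobolevWeight_mul_geometric {s : ℝ} (hs : 0 ≤ s) :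
    Summable fun i : ℕ => sobolevWeight s (200 * (i + 2)) *
      (48 * (2 * ((i + 1 : ℕ) : ℝ) + 1) ^ 2 * (1 / 2) ^ (i + 1)) := by
  obtain ⟨n, hn⟩ := exists_nat_ge s
  have h := ((summable_nat_add_iff 2).2 (summable_pow_mul_geometric_of_norm_lt_one
    (R := ℝ) (2 * n + 2) (r := 1 / 2) (by norm_num))).mul_left
      ((200 ^ 2 : ℝ) ^ s * 2 ^ n * (48 * 2 ^ 2 * 2))
  refine Summable.of_nonneg_of_le (fun i => mul_nonneg
    (zero_le_one.trans (one_le_sobolevWeight hs _)) (by positivity)) (fun i => ?_) h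
  have h1 : sobolevWeight s (i + 2) ≤ 2 ^ n * ((i + 2 : ℕ) : ℝ) ^ (2 * n) := by
    have hi : (1 : ℝ) ≤ ((i + 2 : ℕ) : ℝ) ^ 2 := one_le_pow₀ (by push_cast; linarith)
    calc sobolevWeight s (i + 2) ≤ (1 + ((i + 2 : ℕ) : ℝ) ^ 2) ^ (n : ℝ) :=
          Real.rpow_le_rpow_of_exponent_le (by linarith) hn
      _ ≤ (2 * ((i + 2 : ℕ) : ℝ) ^ 2) ^ n := by
          rw [Real.rpow_natCast]
          exact pow_le_pow_left₀ (by positivity) (by linarith) n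
      _ = _ := by rw [mul_pow, ← pow_mul]
  have h2 : (2 * ((i + 1 : ℕ) : ℝ) + 1) ^ 2 ≤ (2 * ((i + 2 : ℕ) : ℝ)) ^ 2 :=
    pow_le_pow_left₀ (by positivity) (by push_cast; linarith) 2
  calc _ ≤ ((200 ^ 2 : ℝ) ^ s * (2 ^ n * ((i + 2 : ℕ) : ℝ) ^ (2 * n))) *
        (48 * (2 * ((i + 2 : ℕ) : ℝ)) ^ 2 * (1 / 2) ^ (i + 1)) := by
        refine mul_le_mul ((sobolevWeight_mul_le hs _).trans ?_) ?_ (by positivity) (by positivity)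
        · gcongr
        · gcongr
    _ = _ := by ring

/-- Theorem 2: bounded `Hˢ` norms for the resonant equation
`i∂ₜu = −∂ₓₓu + 2δ cos x cos t · u`, written in Fourier variables:
`i cⱼ'(t) = j² cⱼ(t) + δ cos t (c_{j−1}(t) + c_{j+1}(t))`. -/
theorem bounded_sobolev_norms :
    ∃ δ₀ > (0 : ℝ), ∀ δ : ℝ, 0 < δ → δ < δ₀ →
      ∀ s : ℝ, 0 < s → ∃ Cs : ℝ,
        ∀ c : ℤ → ℝ → ℂ,
          (∀ j : ℤ, ContDiff ℝ 1 (c j)) →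
          (∀ (j : ℤ) (t : ℝ),
            Complex.I * deriv (c j) t =
              ((j : ℂ) ^ 2) * c j t +
                (δ : ℂ) * (Real.cos t : ℂ) * (c (j - 1) t + c (j + 1) t)) →
          (∀ t : ℝ, Summable (fun j : ℤ => (1 + (j : ℝ) ^ 2) ^ s * ‖c j t‖ ^ 2)) →
          ∀ t : ℝ,
            (∑' j : ℤ, (1 + (j : ℝ) ^ 2) ^ s * ‖c j t‖ ^ 2) ≤
              Cs * ∑' j : ℤ, (1 + (j : ℝ) ^ 2) ^ s * ‖c j 0‖ ^ 2 := by
  refine ⟨1 / 10000, by norm_num, fun δ hδ hδ' s hs => ?_⟩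
  refine ⟨sobolevWeight s 200 + 6 * (200 ^ 2 : ℝ) ^ s +
    ∑' i : ℕ, sobolevWeight s (200 * (i + 2)) *
      (48 * (2 * ((i + 1 : ℕ) : ℝ) + 1) ^ 2 * (1 / 2) ^ (i + 1)), fun c hd hode hsum t => ?_⟩
  have hc : IsFourierSolution δ c := fun j t => by
    refine ((hd j).differentiable one_ne_zero t).hasDerivAt.congr_deriv ?_
    rw [← hode j t, ← mul_assoc, neg_mul, Complex.I_mul_I, neg_neg, one_mul]
  have hw : ∀ j : ℤ, (1 + (j : ℝ) ^ 2) ^ s = sobolevWeight s j.natAbs := fun j => by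
    rw [sobolevWeight, Nat.cast_natAbs, Int.cast_abs, sq_abs]
  simp only [hw] at hsum ⊢
  have hs₂ : ∀ t, Summable fun j => ‖c j t‖ ^ 2 := fun t =>
    Summable.of_nonneg_of_le (fun j => by positivity)
      (fun j => le_mul_of_one_le_left (by positivity) (one_le_sobolevWeight hs.le _)) (hsum t)
  refine (hsum t).tsum_le_of_sum_le fun F => ?_
  have hδ1 : |δ| ≤ 1 := abs_le.2 ⟨by linarith, by linarith⟩
  refine sum_weight_mul_le (x := fun j => ‖c j t‖ ^ 2) (y := fun j => ‖c j 0‖ ^ 2)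
    (g := fun ℓ => 48 * (2 * (ℓ : ℝ) + 1) ^ 2 * (1 / 2) ^ ℓ)
    (monotone_sobolevWeight hs.le) (one_le_sobolevWeight hs.le) (sobolevWeight_mul_le hs.le)
    (fun n => by positivity) (fun M => (summable_sobolevWeight_mul_geometric hs.le).sum_le_tsum _
      fun i _ => mul_nonneg (zero_le_one.trans (one_le_sobolevWeight hs.le _)) (by positivity))
    (fun j => by positivity) (fun j => by positivity) (hsum 0) (fun F => ?_)
    (fun ℓ hℓ F hF => ?_) F
  · rw [hc.tsum_norm_sq_eq hδ1 hs₂ 0 t]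
    exact (hs₂ t).sum_le_tsum F fun j _ => by positivity
  · refine hc.sum_high_le hδ hδ'.le hs₂ hℓ (fun F hF => ?_) t fun j hj => ?_
    · have hle : Summable fun j : ℤ => if ℓ < j.natAbs then ‖c j 0‖ ^ 2 else 0 :=
        Summable.of_nonneg_of_le (fun j => by split_ifs <;> positivity)
          (fun j => by split_ifs <;> simp) (hs₂ 0)
      refine le_trans (le_of_eq (Finset.sum_congr rfl fun j hj => ?_))
        (hle.sum_le_tsum F fun j _ => by split_ifs <;> positivity)
      have := hF j hj
      rw [Int.abs_eq_natAbs] at this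
      rw [if_pos (by omega)]
    · have := hF j hj
      rw [Int.abs_eq_natAbs]
      omega
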